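/- arXiv:2101.09271 — 8 statements merged into one kernel-verified Lean document; each statement's English description precedes it below -/
import Mathlib

section
/- Let T be a CStree on discrete variables X_1,...,X_p with causal order 1,...,p, and let f be a positive distribution in the CStree model M_T. Then for every level k ∈ {1,...,p} and every stage S_i of the staging of level k-1, with stage-defining context (C_i, x_{C_i}) (so C_i is the set of coordinates on which all elements of S_i agree and x_{C_i} their common value), f entails the context-specific conditional independence relation X_k ⊥ X_{[k-1]∖C_i} | X_{C_i} = x_{C_i}. -/
open scoped Classical

namespace CStreeStmt0

variable {p : ℕ} {d : Fin p → ℕ}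

/-- The outcome space `R = ∏ i, Fin (d i)`. -/
abbrev Outcome (d : Fin p → ℕ) := ∀ i : Fin p, Fin (d i)

/-- Marginal of `f` on the coordinates in `S`, evaluated at (the restriction of) `x`. -/
noncomputable def margin (f : Outcome d → ℝ) (S : Finset (Fin p)) (x : Outcome d) : ℝ :=
  ∑ y : Outcome d, if ∀ i ∈ S, y i = x i then f y else 0

/-- `f` is a (strictly) positive probability distribution on the outcome space. -/
def IsPositive (f : Outcome d → ℝ) : Prop :=
  (∀ x, 0 < f x) ∧ ∑ x : Outcome d, f x = 1

/-- `f` entails the context-specific conditional independence relation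
`X_A ⊥ X_B | X_S, X_C = c|_C`. -/
def CSI (f : Outcome d → ℝ) (A B S C : Finset (Fin p)) (c : Outcome d) : Prop :=
  ∀ x : Outcome d, (∀ i ∈ C, x i = c i) →
    margin f (A ∪ B ∪ S ∪ C) x * margin f (S ∪ C) x =
      margin f (A ∪ S ∪ C) x * margin f (B ∪ S ∪ C) x

/-- The conditional probability `f(a | y_{[k-1]})` of `X_k = a` given the first
`k-1` coordinates of `y`. -/
noncomputable def cond (f : Outcome d → ℝ) (k : Fin p) (a : Fin (d k)) (y : Outcome d) : ℝ :=
  margin f (Finset.univ.filter (fun i => i ≤ k)) (Function.update y k a) /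
    margin f (Finset.univ.filter (fun i => i < k)) y

/-- A CStree with causal order `1, …, p`: for each level `k`, a partition of the
outcomes of the first `k-1` variables (represented as cylinder subsets of the full
outcome space depending only on coordinates `< k`) into stages, each of which is a
cylinder set given by a context `(C, c)` with `C ⊆ [k-1]`. -/
structure CStree (p : ℕ) (d : Fin p → ℕ) where
  stages : Fin p → Finset (Set (Outcome d))
  isCylinder : ∀ k : Fin p, ∀ St ∈ stages k,
    ∃ (C : Finset (Fin p)) (c : Outcome d),
      (∀ i ∈ C, i < k) ∧ St = {y : Outcome d | ∀ i ∈ C, y i = c i}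
  partition : ∀ (k : Fin p) (x : Outcome d), ∃! St, St ∈ stages k ∧ x ∈ St

/-- The stage invariances defining a CStree model: within each stage, the
conditional distribution of the next variable is constant. -/
def StageInvariant (T : CStree p d) (f : Outcome d → ℝ) : Prop :=
  ∀ k : Fin p, ∀ St ∈ T.stages k, ∀ y ∈ St, ∀ y' ∈ St, ∀ a : Fin (d k),
    cond f k a y = cond f k a y'

/-- Membership in the CStree model `M_T`. -/
def MemModel (T : CStree p d) (f : Outcome d → ℝ) : Prop :=
  IsPositive f ∧ StageInvariant T f


theorem margin_pos (f : Outcome d → ℝ) (hf : ∀ x, 0 < f x) (S : Finset (Fin p))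
    (x : Outcome d) : 0 < margin f S x := by
  unfold margin
  refine Finset.sum_pos' (fun y _ => ?_) ⟨x, Finset.mem_univ _, ?_⟩
  · split_ifs
    · exact (hf y).le
    · exact le_rfl
  · simpa using hf x

theorem sum_margin (f : Outcome d → ℝ) (C L S : Finset (Fin p)) (hCL : C ⊆ L) (hLS : L ⊆ S)
    (x : Outcome d) :
    (∑ y : Outcome d, if (∀ i ∈ C, y i = x i) ∧ (∀ i, i ∉ L → y i = x i)
      then margin f S y else 0) = margin f (C ∪ (S \ L)) x := by
  have h1 : ∀ y : Outcome d, (if (∀ i ∈ C, y i = x i) ∧ (∀ i, i ∉ L → y i = x i)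
      then margin f S y else 0) = ∑ z : Outcome d,
        if y = (fun i => if i ∈ L then z i else x i) then
          (if ∀ i ∈ C ∪ (S \ L), z i = x i then f z else 0) else 0 := by
    intro y
    unfold margin
    have h2 : ∀ z : Outcome d,
        (((∀ i ∈ C, y i = x i) ∧ (∀ i, i ∉ L → y i = x i)) ∧ ∀ i ∈ S, z i = y i) ↔
        (y = (fun i => if i ∈ L then z i else x i) ∧ ∀ i ∈ C ∪ (S \ L), z i = x i) := by
      intro z
      constructor
      · rintro ⟨⟨hc, hl⟩, hs⟩
        refine ⟨?_, ?_⟩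
        · funext i
          by_cases hi : i ∈ L
          · simp [hi, hs i (hLS hi)]
          · simp [hi, hl i hi]
        · intro i hi
          rcases Finset.mem_union.1 hi with h | h
          · rw [hs i (hLS (hCL h)), hc i h]
          · rw [Finset.mem_sdiff] at h
            rw [hs i h.1, hl i h.2]
      · rintro ⟨rfl, h⟩
        refine ⟨⟨fun i hi => ?_, fun i hi => by simp [hi]⟩, fun i hi => ?_⟩
        · simp [hCL hi, h i (Finset.mem_union_left _ hi)]
        · by_cases hl : i ∈ L
          · simp [hl]
          · simp [hl, h i (Finset.mem_union_right _ (Finset.mem_sdiff.2 ⟨hi, hl⟩))]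
    simp only [← ite_and, ← h2]
    by_cases h : (∀ i ∈ C, y i = x i) ∧ (∀ i, i ∉ L → y i = x i)
    · rw [if_pos h]
      refine Finset.sum_congr rfl fun z _ => ?_
      exact if_congr (and_iff_right h).symm rfl rfl
    · simp only [if_neg h, h, false_and, if_false, Finset.sum_const_zero]
  rw [Finset.sum_congr rfl (fun y _ => h1 y), Finset.sum_comm]
  unfold margin
  refine Finset.sum_congr rfl fun z _ => ?_
  rw [Finset.sum_ite_eq' Finset.univ]
  simp

/-- If `f` lies in the CStree model of `T`, then for every level `k`
and every stage `St` of level `k-1` with stage-defining context `(C, c)`,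
`f` entails the CSI relation `X_k ⊥ X_{[k-1] \\ C} | X_C = c|_C`. -/
theorem stage_defining_context_CSI
    (hd : ∀ i, 2 ≤ d i)
    (T : CStree p d) (f : Outcome d → ℝ) (hf : MemModel T f)
    (k : Fin p) (St : Set (Outcome d)) (hSt : St ∈ T.stages k)
    (C : Finset (Fin p)) (c : Outcome d)
    (hC : ∀ i ∈ C, i < k)
    (hcyl : St = {y : Outcome d | ∀ i ∈ C, y i = c i}) :
    CSI f {k} ((Finset.univ.filter (fun i => i < k)) \ C) ∅ C c := by
  obtain ⟨⟨hpos, -⟩, hinv⟩ := hf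
  intro x hx
  set L := Finset.univ.filter (fun i : Fin p => i < k) with hL
  set E := Finset.univ.filter (fun i : Fin p => i ≤ k) with hE
  have hCL : C ⊆ L := fun i hi => by simp [hL, hC i hi]
  have hLE : L ⊆ E := fun i hi => by
    simp only [hL, hE, Finset.mem_filter, Finset.mem_univ, true_and] at hi ⊢
    exact hi.le
  have e1 : {k} ∪ L \ C ∪ ∅ ∪ C = E := by
    ext i
    have := hC i
    simp only [hL, hE, Finset.mem_union, Finset.mem_singleton, Finset.mem_sdiff,
      Finset.mem_filter, Finset.mem_univ, true_and, Finset.notMem_empty, le_iff_lt_or_eq]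
    tauto
  have e2 : L \ C ∪ ∅ ∪ C = L := by
    simp [hCL]
  have e3 : {k} ∪ ∅ ∪ C = C ∪ (E \ L) := by
    ext i
    have : i = k ↔ i ≤ k ∧ ¬ i < k := by
      rw [not_lt]; exact le_antisymm_iff
    simp only [hL, hE, Finset.mem_union, Finset.mem_singleton, Finset.mem_sdiff,
      Finset.mem_filter, Finset.mem_univ, true_and, Finset.notMem_empty]
    tauto
  have e4 : ∅ ∪ C = C ∪ (L \ L) := by simp
  rw [e1, e2, e3, e4, ← sum_margin f C L E hCL hLE x,
    ← sum_margin f C L L hCL (Finset.Subset.refl _) x, Finset.mul_sum, Finset.sum_mul]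
  refine Finset.sum_congr rfl fun y _ => ?_
  split_ifs with h
  · have hyk : y k = x k := h.2 k (by simp [hL])
    have key := hinv k St hSt x (by rw [hcyl]; exact hx) y
      (by rw [hcyl]; exact fun i hi => (h.1 i hi).trans (hx i hi)) (x k)
    unfold cond at key
    rw [Function.update_eq_self, ← hyk, Function.update_eq_self,
      div_eq_div_iff (margin_pos f hpos _ _).ne' (margin_pos f hpos _ _).ne'] at key
    exact key
  · simp

end CStreeStmt0
end

section
/- A positive distribution f on R factorizes according to a CStree T (i.e., f ∈ M_T) if and only if, for every level k ∈ {1,...,p} and every stage S_i of the staging of level k-1 with stage-defining context (C_i, x_{C_i}), f entails the context-specific conditional independence relation X_k ⊥ X_{[k-1]∖C_i} | X_{C_i} = x_{C_i}. -/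
open scoped Classical

namespace CStreeStmt1

variable {p : ℕ} {d : Fin p → ℕ}

/-- The outcome space `R = ∏ i, Fin (d i)`. -/
abbrev Outcome (d : Fin p → ℕ) := ∀ i : Fin p, Fin (d i)

/-- Marginal of `f` on the coordinates in `S`, evaluated at (the restriction of) `x`. -/
noncomputable def margin (f : Outcome d → ℝ) (S : Finset (Fin p)) (x : Outcome d) : ℝ :=
  ∑ y : Outcome d, if ∀ i ∈ S, y i = x i then f y else 0

/-- `f` is a (strictly) positive probability distribution on the outcome space. -/
def IsPositive (f : Outcome d → ℝ) : Prop :=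
  (∀ x, 0 < f x) ∧ ∑ x : Outcome d, f x = 1

/-- `f` entails the context-specific conditional independence relation
`X_A ⊥ X_B | X_S, X_C = c|_C`. -/
def CSI (f : Outcome d → ℝ) (A B S C : Finset (Fin p)) (c : Outcome d) : Prop :=
  ∀ x : Outcome d, (∀ i ∈ C, x i = c i) →
    margin f (A ∪ B ∪ S ∪ C) x * margin f (S ∪ C) x =
      margin f (A ∪ S ∪ C) x * margin f (B ∪ S ∪ C) x

/-- The conditional probability `f(a | y_{[k-1]})` of `X_k = a` given the first
`k-1` coordinates of `y`. -/
noncomputable def cond (f : Outcome d → ℝ) (k : Fin p) (a : Fin (d k)) (y : Outcome d) : ℝ :=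
  margin f (Finset.univ.filter (fun i => i ≤ k)) (Function.update y k a) /
    margin f (Finset.univ.filter (fun i => i < k)) y

/-- A CStree with causal order `1, …, p`: for each level `k`, a partition of the
outcomes of the first `k-1` variables (represented as cylinder subsets of the full
outcome space depending only on coordinates `< k`) into stages, each of which is a
cylinder set given by a context `(C, c)` with `C ⊆ [k-1]`. -/
structure CStree (p : ℕ) (d : Fin p → ℕ) where
  stages : Fin p → Finset (Set (Outcome d))
  isCylinder : ∀ k : Fin p, ∀ St ∈ stages k,
    ∃ (C : Finset (Fin p)) (c : Outcome d),
      (∀ i ∈ C, i < k) ∧ St = {y : Outcome d | ∀ i ∈ C, y i = c i}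
  partition : ∀ (k : Fin p) (x : Outcome d), ∃! St, St ∈ stages k ∧ x ∈ St

/-- The stage invariances defining a CStree model: within each stage, the
conditional distribution of the next variable is constant. -/
def StageInvariant (T : CStree p d) (f : Outcome d → ℝ) : Prop :=
  ∀ k : Fin p, ∀ St ∈ T.stages k, ∀ y ∈ St, ∀ y' ∈ St, ∀ a : Fin (d k),
    cond f k a y = cond f k a y'

/-- Membership in the CStree model `M_T`. -/
def MemModel (T : CStree p d) (f : Outcome d → ℝ) : Prop :=
  IsPositive f ∧ StageInvariant T f


theorem margin_pos {f : Outcome d → ℝ} (hf : ∀ x, 0 < f x) (S : Finset (Fin p))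
    (x : Outcome d) : 0 < margin f S x := by
  unfold margin
  refine Finset.sum_pos' (fun y _ => ?_) ⟨x, Finset.mem_univ _, ?_⟩
  · split_ifs
    · exact (hf y).le
    · exact le_rfl
  · simpa using hf x

theorem margin_congr (f : Outcome d → ℝ) (S : Finset (Fin p)) {x y : Outcome d}
    (h : ∀ i ∈ S, x i = y i) : margin f S x = margin f S y := by
  unfold margin
  refine Finset.sum_congr rfl fun z _ => ?_
  have : (∀ i ∈ S, z i = x i) ↔ (∀ i ∈ S, z i = y i) :=
    ⟨fun g i hi => (g i hi).trans (h i hi), fun g i hi => (g i hi).trans (h i hi).symm⟩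
  simp only [this]

theorem sum_cond {f : Outcome d → ℝ} (hf : ∀ x, 0 < f x) (k : Fin p)
    (C : Finset (Fin p)) (hC : ∀ i ∈ C, i < k) (x : Outcome d) :
    ∑ y : Outcome d, (if ∀ i ∈ C, y i = x i then f y else 0) * cond f k (x k) y
      = margin f (insert k C) x := by
  have h1 : ∀ y : Outcome d,
      (if ∀ i ∈ C, y i = x i then f y else 0) * cond f k (x k) y =
      ∑ z : Outcome d, (if ∀ i ∈ insert k C, z i = x i then f z else 0) *
        ((if ∀ i ∈ Finset.univ.filter (fun i => i < k), y i = z i then f y else 0) /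
          margin f (Finset.univ.filter (fun i => i < k)) z) := by
    intro y
    unfold cond
    conv_lhs => rw [margin.eq_1 f (Finset.univ.filter (fun i => i ≤ k))]
    rw [Finset.sum_div, Finset.mul_sum]
    refine Finset.sum_congr rfl fun z _ => ?_
    by_cases hL : ∀ i ∈ Finset.univ.filter (fun i => i < k), y i = z i
    · rw [margin_congr f _ hL, if_pos hL]
      have e1 : (∀ i ∈ C, y i = x i) ↔ (∀ i ∈ C, z i = x i) := by
        refine forall₂_congr fun i hi => ?_
        rw [hL i (by simpa using hC i hi)]
      have e2 : (∀ i ∈ Finset.univ.filter (fun i => i ≤ k),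
          z i = Function.update y k (x k) i) ↔ z k = x k := by
        constructor
        · intro h
          simpa using h k (by simp)
        · intro h i hi
          by_cases hik : i = k
          · subst hik; simpa using h
          · rw [Function.update_of_ne hik]
            refine (hL i ?_).symm
            simp only [Finset.mem_filter, Finset.mem_univ, true_and] at hi ⊢
            exact lt_of_le_of_ne hi hik
      simp only [e1, e2, Finset.forall_mem_insert]
      by_cases a : ∀ i ∈ C, z i = x i <;> by_cases b : z k = x k <;> simp [a, b]
      ring_nf
    · have e2 : ¬ (∀ i ∈ Finset.univ.filter (fun i => i ≤ k),
          z i = Function.update y k (x k) i) := by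
        intro h
        apply hL
        intro i hi
        simp only [Finset.mem_filter, Finset.mem_univ, true_and] at hi
        have := h i (by simpa using hi.le)
        rw [Function.update_of_ne hi.ne] at this
        exact this.symm
      rw [if_neg hL, if_neg e2]
      simp
  rw [Finset.sum_congr rfl fun y _ => h1 y, Finset.sum_comm]
  conv_rhs => rw [margin.eq_1]
  refine Finset.sum_congr rfl fun z _ => ?_
  rw [← Finset.mul_sum, ← Finset.sum_div]
  have := (margin_pos hf (Finset.univ.filter (fun i => i < k)) z).ne'
  rw [← margin.eq_1, div_self this, mul_one]

/-- A positive distribution `f` factorizes according to the CStree `T`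
(i.e. `f ∈ M_T`) iff for every level `k` and every stage of level `k-1` with
stage-defining context `(C, c)`, `f` entails `X_k ⊥ X_{[k-1] \\ C} | X_C = c|_C`. -/
theorem memModel_iff_CSI
    (hd : ∀ i, 2 ≤ d i)
    (T : CStree p d) (f : Outcome d → ℝ) (hf : IsPositive f) :
    MemModel T f ↔
      ∀ k : Fin p, ∀ St ∈ T.stages k, ∀ (C : Finset (Fin p)) (c : Outcome d),
        (∀ i ∈ C, i < k) → St = {y : Outcome d | ∀ i ∈ C, y i = c i} →
        CSI f {k} ((Finset.univ.filter (fun i => i < k)) \ C) ∅ C c := by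
  have key : ∀ (k : Fin p) (C : Finset (Fin p)), (∀ i ∈ C, i < k) → ∀ c : Outcome d,
      CSI f {k} ((Finset.univ.filter (fun i => i < k)) \ C) ∅ C c ↔
      ∀ x : Outcome d, (∀ i ∈ C, x i = c i) →
        cond f k (x k) x = margin f (insert k C) x / margin f C x := by
    intro k C hC c
    unfold CSI
    refine forall₂_congr fun x _ => ?_
    have s1 : {k} ∪ ((Finset.univ.filter (fun i => i < k)) \ C) ∪ ∅ ∪ C
        = Finset.univ.filter (fun i => i ≤ k) := by
      ext i
      have := hC i
      simp only [Finset.mem_union, Finset.mem_singleton, Finset.mem_sdiff, Finset.mem_filter,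
        Finset.mem_univ, true_and, Finset.notMem_empty, or_false, le_iff_lt_or_eq]
      tauto
    have s2 : ((Finset.univ.filter (fun i => i < k)) \ C) ∪ ∅ ∪ C
        = Finset.univ.filter (fun i => i < k) := by
      ext i
      have := hC i
      simp only [Finset.mem_union, Finset.mem_sdiff, Finset.mem_filter,
        Finset.mem_univ, true_and, Finset.notMem_empty, or_false]
      tauto
    have s3 : {k} ∪ ∅ ∪ C = insert k C := by
      ext i; simp
    have s4 : ∅ ∪ C = C := by simp
    rw [s1, s2, s3, s4]
    unfold cond
    rw [Function.update_eq_self, div_eq_div_iff (margin_pos hf.1 _ _).ne' (margin_pos hf.1 _ _).ne']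
  constructor
  · rintro ⟨_, hT⟩ k St hSt C c hC rfl
    rw [key k C hC c]
    intro x hx
    rw [eq_div_iff (margin_pos hf.1 _ _).ne', ← sum_cond hf.1 k C hC x, margin, Finset.mul_sum]
    refine Finset.sum_congr rfl fun y _ => ?_
    split_ifs with h
    · rw [hT k _ hSt x hx y (fun i hi => (h i hi).trans (hx i hi)) (x k), mul_comm]
    · simp
  · intro H
    refine ⟨hf, ?_⟩
    intro k St hSt y hy y' hy' a
    obtain ⟨C, c, hC, rfl⟩ := T.isCylinder k St hSt
    have h := (key k C hC c).1 (H k _ hSt C c hC rfl)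
    have hne : ∀ i ∈ C, i ≠ k := fun i hi => (hC i hi).ne
    have g : ∀ y : Outcome d, (∀ i ∈ C, y i = c i) →
        cond f k a y = margin f (insert k C) (Function.update c k a) / margin f C c := by
      intro y hy
      have h1 := h (Function.update y k a) (fun i hi => by
        rw [Function.update_of_ne (hne i hi)]; exact hy i hi)
      have h2 : cond f k (Function.update y k a k) (Function.update y k a) = cond f k a y := by
        unfold cond
        rw [Function.update_self, Function.update_idem]
        congr 1
        apply margin_congr
        intro i hi
        simp only [Finset.mem_filter, Finset.mem_univ, true_and] at hi
        rw [Function.update_of_ne hi.ne]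
      rw [← h2, h1]
      congr 1
      · apply margin_congr
        intro i hi
        by_cases hik : i = k
        · subst hik; simp
        · rw [Function.update_of_ne hik, Function.update_of_ne hik]
          exact hy i (Finset.mem_of_mem_insert_of_ne hi hik)
      · apply margin_congr
        intro i hi
        rw [Function.update_of_ne (hne i hi)]; exact hy i hi
    rw [g y hy, g y' hy']

end CStreeStmt1
end

section
/- Let f be a positive distribution on R, let C ⊆ [p] and x_C ∈ R_C, and for each k ∈ [p]∖C let pa(k) ⊆ {j ∈ [p]∖C : j < k}. Then the following are equivalent: (i) for every k ∈ [p]∖C, f entails the context-specific conditional independence relation X_k ⊥ X_{B_k} | X_{pa(k)}, X_C = x_C, where B_k = {j ∈ [p]∖C : j < k} ∖ pa(k); (ii) for every x ∈ R whose restriction to C equals x_C, f(x_{[p]∖C} | x_C) = ∏_{k ∈ [p]∖C} f(x_k | x_{pa(k)}, x_C), where f(x_A | x_B, x_C) denotes the conditional probability f(x_{A∪B∪C})/f(x_{B∪C}). -/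
open scoped Classical

namespace CStreeStmt3

variable {p : ℕ} {d : Fin p → ℕ}

/-- The outcome space `R = ∏ i, Fin (d i)`. -/
abbrev Outcome (d : Fin p → ℕ) := ∀ i : Fin p, Fin (d i)

/-- Marginal of `f` on the coordinates in `S`, evaluated at (the restriction of) `x`. -/
noncomputable def margin (f : Outcome d → ℝ) (S : Finset (Fin p)) (x : Outcome d) : ℝ :=
  ∑ y : Outcome d, if ∀ i ∈ S, y i = x i then f y else 0

/-- `f` is a (strictly) positive probability distribution on the outcome space. -/
def IsPositive (f : Outcome d → ℝ) : Prop :=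
  (∀ x, 0 < f x) ∧ ∑ x : Outcome d, f x = 1

/-- `f` entails the context-specific conditional independence relation
`X_A ⊥ X_B | X_S, X_C = c|_C`. -/
def CSI (f : Outcome d → ℝ) (A B S C : Finset (Fin p)) (c : Outcome d) : Prop :=
  ∀ x : Outcome d, (∀ i ∈ C, x i = c i) →
    margin f (A ∪ B ∪ S ∪ C) x * margin f (S ∪ C) x =
      margin f (A ∪ S ∪ C) x * margin f (B ∪ S ∪ C) x

/-- The conditional probability `f(a | y_{[k-1]})` of `X_k = a` given the first
`k-1` coordinates of `y`. -/
noncomputable def cond (f : Outcome d → ℝ) (k : Fin p) (a : Fin (d k)) (y : Outcome d) : ℝ :=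
  margin f (Finset.univ.filter (fun i => i ≤ k)) (Function.update y k a) /
    margin f (Finset.univ.filter (fun i => i < k)) y

/-- A CStree with causal order `1, …, p`: for each level `k`, a partition of the
outcomes of the first `k-1` variables (represented as cylinder subsets of the full
outcome space depending only on coordinates `< k`) into stages, each of which is a
cylinder set given by a context `(C, c)` with `C ⊆ [k-1]`. -/
structure CStree (p : ℕ) (d : Fin p → ℕ) where
  stages : Fin p → Finset (Set (Outcome d))
  isCylinder : ∀ k : Fin p, ∀ St ∈ stages k,
    ∃ (C : Finset (Fin p)) (c : Outcome d),
      (∀ i ∈ C, i < k) ∧ St = {y : Outcome d | ∀ i ∈ C, y i = c i}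
  partition : ∀ (k : Fin p) (x : Outcome d), ∃! St, St ∈ stages k ∧ x ∈ St

/-- The stage invariances defining a CStree model: within each stage, the
conditional distribution of the next variable is constant. -/
def StageInvariant (T : CStree p d) (f : Outcome d → ℝ) : Prop :=
  ∀ k : Fin p, ∀ St ∈ T.stages k, ∀ y ∈ St, ∀ y' ∈ St, ∀ a : Fin (d k),
    cond f k a y = cond f k a y'

/-- Membership in the CStree model `M_T`. -/
def MemModel (T : CStree p d) (f : Outcome d → ℝ) : Prop :=
  IsPositive f ∧ StageInvariant T f


theorem aux_margin_congr (f : Outcome d → ℝ) (S : Finset (Fin p)) (x x' : Outcome d)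
    (h : ∀ i ∈ S, x i = x' i) : margin f S x = margin f S x' := by
  unfold margin
  refine Finset.sum_congr rfl fun y _ => ?_
  have : (∀ i ∈ S, y i = x i) ↔ (∀ i ∈ S, y i = x' i) :=
    ⟨fun g i hi => (g i hi).trans (h i hi), fun g i hi => (g i hi).trans (h i hi).symm⟩
  simp only [this]

theorem aux_margin_pos (f : Outcome d → ℝ) (hf : ∀ x, 0 < f x) (S : Finset (Fin p))
    (x : Outcome d) : 0 < margin f S x := by
  unfold margin
  refine Finset.sum_pos' (fun y _ => ?_) ⟨x, Finset.mem_univ _, ?_⟩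
  · split_ifs
    · exact (hf y).le
    · exact le_rfl
  · simpa using hf x

theorem aux_margin_univ (f : Outcome d → ℝ) (S : Finset (Fin p)) (hS : ∀ i, i ∈ S)
    (x : Outcome d) : margin f S x = f x := by
  unfold margin
  have : ∀ y : Outcome d, (∀ i ∈ S, y i = x i) ↔ y = x := fun y =>
    ⟨fun h => funext fun i => h i (hS i), fun h i _ => by rw [h]⟩
  simp only [this]
  simp

theorem aux_margin_sum (f : Outcome d → ℝ) (S S' : Finset (Fin p)) (k : Fin p) (hk : k ∉ S)
    (hS : ∀ i, i ∈ S' ↔ i = k ∨ i ∈ S) (x : Outcome d) :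
    ∑ a : Fin (d k), margin f S' (Function.update x k a) = margin f S x := by
  unfold margin
  rw [Finset.sum_comm]
  refine Finset.sum_congr rfl fun y _ => ?_
  have : ∀ a : Fin (d k), (∀ i ∈ S', y i = Function.update x k a i) ↔
      (y k = a ∧ ∀ i ∈ S, y i = x i) := by
    intro a
    constructor
    · intro h
      refine ⟨by simpa using h k ((hS k).2 (Or.inl rfl)), fun i hi => ?_⟩
      have hne : i ≠ k := fun e => hk (e ▸ hi)
      simpa [hne] using h i ((hS i).2 (Or.inr hi))
    · rintro ⟨h1, h2⟩ i hi
      by_cases e : i = k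
      · subst e; simpa using h1
      · simpa [e] using h2 i (((hS i).1 hi).resolve_left e)
  simp only [this, ite_and]
  simp

/-- coordinates in the context or of index below `n` -/
noncomputable def auxP (C : Finset (Fin p)) (n : ℕ) : Finset (Fin p) :=
  Finset.univ.filter (fun j => j ∈ C ∨ j.val < n)

/-- coordinates outside the context of index below `n` -/
noncomputable def auxT (C : Finset (Fin p)) (n : ℕ) : Finset (Fin p) :=
  Finset.univ.filter (fun j => j ∉ C ∧ j.val < n)

theorem aux_T_succ (C : Finset (Fin p)) (k : Fin p) (hk : k ∉ C) (g : Fin p → ℝ) :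
    ∏ j ∈ auxT C (k.val + 1), g j = (∏ j ∈ auxT C k.val, g j) * g k := by
  have : auxT C (k.val + 1) = insert k (auxT C k.val) := by
    ext j
    simp only [auxT, Finset.mem_filter, Finset.mem_univ, true_and, Finset.mem_insert, Fin.ext_iff]
    constructor
    · rintro ⟨h1, h2⟩
      by_cases e : j.val = k.val
      · exact Or.inl e
      · exact Or.inr ⟨h1, by omega⟩
    · rintro (h | ⟨h1, h2⟩)
      · refine ⟨?_, by omega⟩
        rwa [Fin.ext h]
      · exact ⟨h1, by omega⟩
  rw [this, Finset.prod_insert (by simp [auxT]), mul_comm]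

theorem aux_succ_mem (C : Finset (Fin p)) (k : Fin p) (hk : k ∈ C) :
    auxT C (k.val + 1) = auxT C k.val ∧ auxP C (k.val + 1) = auxP C k.val := by
  have key : ∀ j : Fin p, j ∉ C → (j.val < k.val + 1 ↔ j.val < k.val) := by
    intro j hj
    have : j.val ≠ k.val := fun e => hj (by rwa [Fin.ext e])
    omega
  constructor
  · ext j
    simp only [auxT, Finset.mem_filter, Finset.mem_univ, true_and]
    exact and_congr_right fun h => key j h
  · ext j
    simp only [auxP, Finset.mem_filter, Finset.mem_univ, true_and]
    have := key j
    tauto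

theorem aux_csi_iff (f : Outcome d → ℝ) (hf : ∀ x, 0 < f x)
    (C : Finset (Fin p)) (c : Outcome d) (P : Finset (Fin p)) (k : Fin p)
    (hpa : ∀ j ∈ P, j ∉ C ∧ j < k) :
    CSI f {k} ((Finset.univ.filter (fun j => j ∉ C ∧ j < k)) \ P) P C c ↔
    ∀ x : Outcome d, (∀ i ∈ C, x i = c i) →
      margin f (auxP C (k.val + 1)) x = margin f (auxP C k.val) x *
        (margin f ({k} ∪ P ∪ C) x / margin f (P ∪ C) x) := by
  have h1 : (Finset.univ.filter (fun j => j ∉ C ∧ j < k)) \ P ∪ P ∪ C = auxP C k.val := by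
    ext j
    have := hpa j
    simp only [auxP, Finset.mem_filter, Finset.mem_univ, true_and, Finset.mem_union,
      Finset.mem_sdiff, ← Fin.lt_def]
    tauto
  have h2 : {k} ∪ (Finset.univ.filter (fun j => j ∉ C ∧ j < k)) \ P ∪ P ∪ C
      = auxP C (k.val + 1) := by
    ext j
    have := hpa j
    have e : j.val < k.val + 1 ↔ j = k ∨ j < k := by
      rw [Fin.ext_iff, Fin.lt_def]; omega
    simp only [auxP, Finset.mem_filter, Finset.mem_univ, true_and, Finset.mem_union,
      Finset.mem_sdiff, e, Finset.mem_singleton]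
    tauto
  unfold CSI
  rw [h1, h2]
  refine forall_congr' fun x => forall_congr' fun _ => ?_
  have := (aux_margin_pos f hf (P ∪ C) x).ne'
  rw [← mul_div_assoc, eq_div_iff this, mul_comm (margin f (auxP C k.val) x)]

/-- Context-specific ordered Markov property vs. recursive
factorization: for a positive `f`, a context `(C, c)` and parent sets
`pa k ⊆ {j ∉ C : j < k}` for `k ∉ C`, the CSI relations
`X_k ⊥ X_{B_k} | X_{pa k}, X_C = c|_C` (with `B_k = {j ∉ C : j < k} \\ pa k`)
hold for all `k ∉ C` iff `f(x_{[p] \\ C} | x_C) = ∏_{k ∉ C} f(x_k | x_{pa k}, x_C)`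
for all `x` agreeing with `c` on `C`. -/
theorem csi_iff_factorization
    (hd : ∀ i, 2 ≤ d i)
    (f : Outcome d → ℝ) (hf : IsPositive f)
    (C : Finset (Fin p)) (c : Outcome d)
    (pa : Fin p → Finset (Fin p))
    (hpa : ∀ k, k ∉ C → ∀ j ∈ pa k, j ∉ C ∧ j < k) :
    (∀ k : Fin p, k ∉ C →
        CSI f {k} ((Finset.univ.filter (fun j => j ∉ C ∧ j < k)) \ pa k) (pa k) C c)
      ↔
    (∀ x : Outcome d, (∀ i ∈ C, x i = c i) →
        f x / margin f C x =
          ∏ k ∈ Finset.univ \ C,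
            margin f ({k} ∪ pa k ∪ C) x / margin f (pa k ∪ C) x) := by
  have hpos := aux_margin_pos f hf.1
  have hagree : ∀ (k : Fin p) (_ : k ∉ C) (x : Outcome d) (a : Fin (d k)),
      (∀ i ∈ C, x i = c i) → ∀ i ∈ C, Function.update x k a i = c i := by
    intro k hk x a hx i hi
    have : i ≠ k := fun e => hk (e ▸ hi)
    simpa [this] using hx i hi
  have hP0 : auxP C 0 = C := by ext j; simp [auxP]
  have hT0 : auxT C 0 = ∅ := by ext j; simp [auxT]
  have hTp : auxT C p = Finset.univ \ C := by ext j; simp [auxT]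
  have hPp : ∀ x, margin f (auxP C p) x = f x :=
    aux_margin_univ f _ (fun i => by simp [auxP])
  constructor
  · intro h x hx
    have key : ∀ n, n ≤ p → margin f (auxP C n) x = margin f C x *
        ∏ k ∈ auxT C n, margin f ({k} ∪ pa k ∪ C) x / margin f (pa k ∪ C) x := by
      intro n
      induction n with
      | zero => intro _; rw [hP0, hT0]; simp
      | succ n ih =>
        intro hn
        have ih := ih (by omega)
        by_cases hk : (⟨n, hn⟩ : Fin p) ∈ C
        · obtain ⟨e1, e2⟩ := aux_succ_mem C ⟨n, hn⟩ hk
          simp only at e1 e2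
          rw [e1, e2, ih]
        · have e1 := aux_T_succ C ⟨n, hn⟩ hk
            (fun k => margin f ({k} ∪ pa k ∪ C) x / margin f (pa k ∪ C) x)
          have e2 := (aux_csi_iff f hf.1 C c (pa ⟨n, hn⟩) ⟨n, hn⟩ (hpa _ hk)).1 (h _ hk) x hx
          simp only at e1 e2
          rw [e1, e2, ih, mul_assoc]
    have := key p le_rfl
    rw [hPp, hTp] at this
    rw [this, mul_div_cancel_left₀ _ (hpos C x).ne']
  · intro h
    have key : ∀ m n, n + m = p → ∀ x : Outcome d, (∀ i ∈ C, x i = c i) →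
        margin f (auxP C n) x = margin f C x *
        ∏ k ∈ auxT C n, margin f ({k} ∪ pa k ∪ C) x / margin f (pa k ∪ C) x := by
      intro m
      induction m with
      | zero =>
        intro n hn x hx
        obtain rfl : n = p := by omega
        rw [hPp, hTp, ← h x hx, mul_div_cancel₀ _ (hpos C x).ne']
      | succ m ih =>
        intro n hn x hx
        have hn' : n < p := by omega
        have ih := ih (n + 1) (by omega)
        obtain ⟨k, rfl⟩ : ∃ k : Fin p, k.val = n := ⟨⟨n, hn'⟩, rfl⟩
        by_cases hk : k ∈ C
        · obtain ⟨e1, e2⟩ := aux_succ_mem C k hk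
          rw [← e1, ← e2]
          exact ih x hx
        · have hkpa : k ∉ pa k := fun hh => lt_irrefl _ (hpa k hk k hh).2
          rw [← aux_margin_sum f (auxP C k.val) (auxP C (k.val + 1)) k (by simp [auxP, hk])
            (fun i => by
              simp only [auxP, Finset.mem_filter, Finset.mem_univ, true_and, Fin.ext_iff]
              have : i.val < k.val + 1 ↔ i.val = k.val ∨ i.val < k.val := by omega
              tauto) x]
          have step : ∀ a : Fin (d k), margin f (auxP C (k.val + 1)) (Function.update x k a) =
              (margin f C x * ∏ j ∈ auxT C k.val,
                margin f ({j} ∪ pa j ∪ C) x / margin f (pa j ∪ C) x) *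
              (margin f ({k} ∪ pa k ∪ C) (Function.update x k a) / margin f (pa k ∪ C) x) := by
            intro a
            have cong : ∀ S : Finset (Fin p), k ∉ S →
                margin f S (Function.update x k a) = margin f S x := by
              intro S hS
              refine aux_margin_congr f S _ _ fun i hi => ?_
              have : i ≠ k := fun e => hS (e ▸ hi)
              simp [this]
            rw [ih _ (hagree k hk x a hx), aux_T_succ C k hk, cong C hk,
              cong (pa k ∪ C) (by simp [hk, hkpa]), mul_assoc]
            congr 2
            refine Finset.prod_congr rfl fun j hj => ?_
            simp only [auxT, Finset.mem_filter, Finset.mem_univ, true_and] at hj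
            have hkj : k ∉ pa j := fun hh => by
              have := (hpa j hj.1 k hh).2
              rw [Fin.lt_def] at this
              omega
            have hne : k ≠ j := fun e => by
              have := hj.2
              rw [e] at this
              omega
            rw [cong _ (by simp [hk, hkj, hne]), cong _ (by simp [hk, hkj])]
          rw [Finset.sum_congr rfl fun a _ => step a, ← Finset.mul_sum, ← Finset.sum_div,
            aux_margin_sum f (pa k ∪ C) ({k} ∪ pa k ∪ C) k (by simp [hk, hkpa])
              (fun i => by simp [or_assoc]) x, div_self (hpos _ x).ne', mul_one]
    intro k hk
    rw [aux_csi_iff f hf.1 C c (pa k) k (hpa k hk)]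
    intro x hx
    rw [key (p - (k.val + 1)) (k.val + 1) (by omega) x hx, key (p - k.val) k.val (by omega) x hx,
      aux_T_succ C k hk, mul_assoc]

end CStreeStmt3
end

section
/- (Weak union axiom, semantic form.) Let f be a positive distribution on R and let A, B, D, S, C ⊆ [p] be pairwise disjoint and x_C ∈ R_C. If f entails the context-specific conditional independence relation X_A ⊥ X_{B∪D} | X_S, X_C = x_C, then f entails X_A ⊥ X_B | X_{S∪D}, X_C = x_C. -/
open scoped Classical

namespace CStreeStmt5

variable {p : ℕ} {d : Fin p → ℕ}

/-- The outcome space `R = ∏ i, Fin (d i)`. -/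
abbrev Outcome (d : Fin p → ℕ) := ∀ i : Fin p, Fin (d i)

/-- Marginal of `f` on the coordinates in `S`, evaluated at (the restriction of) `x`. -/
noncomputable def margin (f : Outcome d → ℝ) (S : Finset (Fin p)) (x : Outcome d) : ℝ :=
  ∑ y : Outcome d, if ∀ i ∈ S, y i = x i then f y else 0

/-- `f` is a (strictly) positive probability distribution on the outcome space. -/
def IsPositive (f : Outcome d → ℝ) : Prop :=
  (∀ x, 0 < f x) ∧ ∑ x : Outcome d, f x = 1

/-- `f` entails the context-specific conditional independence relation
`X_A ⊥ X_B | X_S, X_C = c|_C`. -/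
def CSI (f : Outcome d → ℝ) (A B S C : Finset (Fin p)) (c : Outcome d) : Prop :=
  ∀ x : Outcome d, (∀ i ∈ C, x i = c i) →
    margin f (A ∪ B ∪ S ∪ C) x * margin f (S ∪ C) x =
      margin f (A ∪ S ∪ C) x * margin f (B ∪ S ∪ C) x

/-- The conditional probability `f(a | y_{[k-1]})` of `X_k = a` given the first
`k-1` coordinates of `y`. -/
noncomputable def cond (f : Outcome d → ℝ) (k : Fin p) (a : Fin (d k)) (y : Outcome d) : ℝ :=
  margin f (Finset.univ.filter (fun i => i ≤ k)) (Function.update y k a) /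
    margin f (Finset.univ.filter (fun i => i < k)) y

/-- A CStree with causal order `1, …, p`: for each level `k`, a partition of the
outcomes of the first `k-1` variables (represented as cylinder subsets of the full
outcome space depending only on coordinates `< k`) into stages, each of which is a
cylinder set given by a context `(C, c)` with `C ⊆ [k-1]`. -/
structure CStree (p : ℕ) (d : Fin p → ℕ) where
  stages : Fin p → Finset (Set (Outcome d))
  isCylinder : ∀ k : Fin p, ∀ St ∈ stages k,
    ∃ (C : Finset (Fin p)) (c : Outcome d),
      (∀ i ∈ C, i < k) ∧ St = {y : Outcome d | ∀ i ∈ C, y i = c i}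
  partition : ∀ (k : Fin p) (x : Outcome d), ∃! St, St ∈ stages k ∧ x ∈ St

/-- The stage invariances defining a CStree model: within each stage, the
conditional distribution of the next variable is constant. -/
def StageInvariant (T : CStree p d) (f : Outcome d → ℝ) : Prop :=
  ∀ k : Fin p, ∀ St ∈ T.stages k, ∀ y ∈ St, ∀ y' ∈ St, ∀ a : Fin (d k),
    cond f k a y = cond f k a y'

/-- Membership in the CStree model `M_T`. -/
def MemModel (T : CStree p d) (f : Outcome d → ℝ) : Prop :=
  IsPositive f ∧ StageInvariant T f


theorem margin_congr_aux {p : ℕ} {d : Fin p → ℕ} (f : Outcome d → ℝ) (K : Finset (Fin p))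
    (x z : Outcome d) (h : ∀ i ∈ K, z i = x i) : margin f K z = margin f K x := by
  unfold margin
  refine Finset.sum_congr rfl fun y _ => ?_
  have : (∀ i ∈ K, y i = z i) ↔ (∀ i ∈ K, y i = x i) :=
    forall₂_congr fun i hi => by rw [h i hi]
  simp only [this]

theorem margin_sum_aux {p : ℕ} {d : Fin p → ℕ} (f : Outcome d → ℝ) (K B : Finset (Fin p))
    (hKB : Disjoint K B) (x : Outcome d) :
    margin f K x = ∑ z : Outcome d, if ∀ i, i ∉ B → z i = x i then margin f (K ∪ B) z else 0 := by
  have hK : ∀ i ∈ K, i ∉ B := fun i hi => Finset.disjoint_left.mp hKB hi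
  have e : ∀ z : Outcome d, (if ∀ i, i ∉ B → z i = x i then margin f (K ∪ B) z else 0) =
      ∑ y : Outcome d, if (∀ i ∈ K, y i = x i) ∧ z = (fun i => if i ∈ B then y i else x i)
        then f y else 0 := by
    intro z
    unfold margin
    split_ifs with hz
    · refine Finset.sum_congr rfl fun y _ => ?_
      congr 1
      rw [eq_iff_iff]
      constructor
      · intro h
        refine ⟨fun i hi => ?_, ?_⟩
        · rw [h i (Finset.mem_union_left _ hi), hz i (hK i hi)]
        · funext i
          by_cases hi : i ∈ B
          · simp [hi, h i (Finset.mem_union_right _ hi)]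
          · simp [hi, hz i hi]
      · rintro ⟨h1, h2⟩ i hi
        by_cases hB : i ∈ B
        · rw [h2]; simp [hB]
        · rw [hz i hB]
          exact h1 i ((Finset.mem_union.mp hi).resolve_right hB)
    · symm
      refine Finset.sum_eq_zero fun y _ => ?_
      rw [if_neg]
      rintro ⟨-, h2⟩
      apply hz
      intro i hi
      rw [h2]; simp [hi]
  rw [Finset.sum_congr rfl fun z _ => e z, Finset.sum_comm]
  unfold margin
  refine Finset.sum_congr rfl fun y _ => ?_
  by_cases h : ∀ i ∈ K, y i = x i
  · rw [if_pos h]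
    rw [Finset.sum_eq_single (fun i => if i ∈ B then y i else x i)]
    · rw [if_pos ⟨h, rfl⟩]
    · intro z _ hz
      rw [if_neg (fun hh => hz hh.2)]
    · intro hh
      exact absurd (Finset.mem_univ _) hh
  · simp [h]

/-- **Weak union axiom, semantic form.** -/
theorem csi_weak_union
    {p : ℕ} {d : Fin p → ℕ} (hd : ∀ i, 2 ≤ d i)
    (f : Outcome d → ℝ) (hf : IsPositive f)
    (A B D S C : Finset (Fin p))
    (hAB : Disjoint A B) (hAD : Disjoint A D) (hAS : Disjoint A S) (hAC : Disjoint A C)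
    (hBD : Disjoint B D) (hBS : Disjoint B S) (hBC : Disjoint B C)
    (hDS : Disjoint D S) (hDC : Disjoint D C) (hSC : Disjoint S C)
    (c : Outcome d)
    (h : CSI f A (B ∪ D) S C c) :
    CSI f A B (S ∪ D) C c := by
  intro x hx
  have hpos : 0 < margin f (S ∪ C) x := by
    unfold margin
    refine Finset.sum_pos' (fun y _ => ?_) ⟨x, Finset.mem_univ _, ?_⟩
    · split_ifs
      · exact (hf.1 y).le
      · exact le_rfl
    · simpa using hf.1 x
  have hB : ∀ i ∈ B, i ∉ A ∧ i ∉ D ∧ i ∉ S ∧ i ∉ C := fun i hi =>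
    ⟨Finset.disjoint_right.mp hAB hi, Finset.disjoint_left.mp hBD hi,
      Finset.disjoint_left.mp hBS hi, Finset.disjoint_left.mp hBC hi⟩
  have hdec : margin f (A ∪ S ∪ D ∪ C) x * margin f (S ∪ C) x =
      margin f (A ∪ S ∪ C) x * margin f (S ∪ D ∪ C) x := by
    rw [margin_sum_aux f (A ∪ S ∪ D ∪ C) B (by rw [Finset.disjoint_right]; grind) x,
      margin_sum_aux f (S ∪ D ∪ C) B (by rw [Finset.disjoint_right]; grind) x,
      Finset.sum_mul, Finset.mul_sum]
    refine Finset.sum_congr rfl fun z _ => ?_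
    split_ifs with hz
    · have hz' := h z (fun i hi => by
        rw [hz i (fun hb => (hB i hb).2.2.2 hi), hx i hi])
      rw [margin_congr_aux f (S ∪ C) x z (fun i hi => hz i (by grind)),
        margin_congr_aux f (A ∪ S ∪ C) x z (fun i hi => hz i (by grind))] at hz'
      have e1 : A ∪ S ∪ D ∪ C ∪ B = A ∪ (B ∪ D) ∪ S ∪ C := by grind
      have e2 : S ∪ D ∪ C ∪ B = B ∪ D ∪ S ∪ C := by grind
      rw [e1, e2]
      exact hz'
    · simp
  have h0 := h x hx
  have e1 : A ∪ B ∪ (S ∪ D) ∪ C = A ∪ (B ∪ D) ∪ S ∪ C := by grind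
  have e2 : B ∪ (S ∪ D) ∪ C = B ∪ D ∪ S ∪ C := by grind
  have e3 : A ∪ (S ∪ D) ∪ C = A ∪ S ∪ D ∪ C := by grind
  rw [e1, e2, e3]
  apply mul_right_cancel₀ hpos.ne'
  linear_combination margin f (S ∪ D ∪ C) x * h0 - margin f (B ∪ D ∪ S ∪ C) x * hdec

end CStreeStmt5
end

section
/- (Intersection axiom, semantic form.) Let f be a positive distribution on R and let A, B, D, S, C ⊆ [p] be pairwise disjoint and x_C ∈ R_C. If f entails the context-specific conditional independence relations X_A ⊥ X_B | X_{S∪D}, X_C = x_C and X_A ⊥ X_S | X_{B∪D}, X_C = x_C, then f entails X_A ⊥ X_{B∪S} | X_D, X_C = x_C. -/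
open scoped Classical

namespace CStreeStmt7

variable {p : ℕ} {d : Fin p → ℕ}

/-- The outcome space `R = ∏ i, Fin (d i)`. -/
abbrev Outcome (d : Fin p → ℕ) := ∀ i : Fin p, Fin (d i)

/-- Marginal of `f` on the coordinates in `S`, evaluated at (the restriction of) `x`. -/
noncomputable def margin (f : Outcome d → ℝ) (S : Finset (Fin p)) (x : Outcome d) : ℝ :=
  ∑ y : Outcome d, if ∀ i ∈ S, y i = x i then f y else 0

/-- `f` is a (strictly) positive probability distribution on the outcome space. -/
def IsPositive (f : Outcome d → ℝ) : Prop :=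
  (∀ x, 0 < f x) ∧ ∑ x : Outcome d, f x = 1

/-- `f` entails the context-specific conditional independence relation
`X_A ⊥ X_B | X_S, X_C = c|_C`. -/
def CSI (f : Outcome d → ℝ) (A B S C : Finset (Fin p)) (c : Outcome d) : Prop :=
  ∀ x : Outcome d, (∀ i ∈ C, x i = c i) →
    margin f (A ∪ B ∪ S ∪ C) x * margin f (S ∪ C) x =
      margin f (A ∪ S ∪ C) x * margin f (B ∪ S ∪ C) x

/-- The conditional probability `f(a | y_{[k-1]})` of `X_k = a` given the first
`k-1` coordinates of `y`. -/
noncomputable def cond (f : Outcome d → ℝ) (k : Fin p) (a : Fin (d k)) (y : Outcome d) : ℝ :=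
  margin f (Finset.univ.filter (fun i => i ≤ k)) (Function.update y k a) /
    margin f (Finset.univ.filter (fun i => i < k)) y

/-- A CStree with causal order `1, …, p`: for each level `k`, a partition of the
outcomes of the first `k-1` variables (represented as cylinder subsets of the full
outcome space depending only on coordinates `< k`) into stages, each of which is a
cylinder set given by a context `(C, c)` with `C ⊆ [k-1]`. -/
structure CStree (p : ℕ) (d : Fin p → ℕ) where
  stages : Fin p → Finset (Set (Outcome d))
  isCylinder : ∀ k : Fin p, ∀ St ∈ stages k,
    ∃ (C : Finset (Fin p)) (c : Outcome d),
      (∀ i ∈ C, i < k) ∧ St = {y : Outcome d | ∀ i ∈ C, y i = c i}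
  partition : ∀ (k : Fin p) (x : Outcome d), ∃! St, St ∈ stages k ∧ x ∈ St

/-- The stage invariances defining a CStree model: within each stage, the
conditional distribution of the next variable is constant. -/
def StageInvariant (T : CStree p d) (f : Outcome d → ℝ) : Prop :=
  ∀ k : Fin p, ∀ St ∈ T.stages k, ∀ y ∈ St, ∀ y' ∈ St, ∀ a : Fin (d k),
    cond f k a y = cond f k a y'

/-- Membership in the CStree model `M_T`. -/
def MemModel (T : CStree p d) (f : Outcome d → ℝ) : Prop :=
  IsPositive f ∧ StageInvariant T f


theorem margin_congr' (f : Outcome d → ℝ) (T : Finset (Fin p)) (x y : Outcome d)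
    (h : ∀ i ∈ T, y i = x i) : margin f T y = margin f T x := by
  unfold margin
  refine Finset.sum_congr rfl fun z _ => ?_
  have : (∀ i ∈ T, z i = y i) ↔ (∀ i ∈ T, z i = x i) :=
    forall₂_congr fun i hi => by rw [h i hi]
  simp only [this]

theorem margin_pos' (f : Outcome d → ℝ) (hf : ∀ x, 0 < f x) (T : Finset (Fin p))
    (x : Outcome d) : 0 < margin f T x := by
  unfold margin
  refine Finset.sum_pos' (fun y _ => ?_) ⟨x, Finset.mem_univ _, ?_⟩
  · split_ifs
    · exact (hf y).le
    · exact le_rfl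
  · simpa using hf x

theorem sum_margin' (f : Outcome d → ℝ) (T B : Finset (Fin p)) (hTB : Disjoint T B)
    (x : Outcome d) :
    ∑ y : Outcome d, (if ∀ i, i ∉ B → y i = x i then margin f (T ∪ B) y else 0)
      = margin f T x := by
  unfold margin
  have e : ∀ y : Outcome d, (if ∀ i, i ∉ B → y i = x i then
      (∑ z : Outcome d, if ∀ i ∈ T ∪ B, z i = y i then f z else 0) else 0)
      = ∑ z : Outcome d, if (∀ i, i ∉ B → y i = x i) ∧ ∀ i ∈ T ∪ B, z i = y i
          then f z else 0 := by
    intro y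
    by_cases h : ∀ i, i ∉ B → y i = x i
    · rw [if_pos h]
      exact Finset.sum_congr rfl fun z _ => if_congr (and_iff_right h).symm rfl rfl
    · simp only [h, if_false, false_and, Finset.sum_const_zero]
  simp only [e]
  rw [Finset.sum_comm]
  refine Finset.sum_congr rfl fun z _ => ?_
  by_cases hz : ∀ i ∈ T, z i = x i
  · rw [if_pos hz, Finset.sum_eq_single (fun i => if i ∈ B then z i else x i)]
    · rw [if_pos]
      refine ⟨fun i hi => by simp [hi], fun i hi => ?_⟩
      by_cases hB : i ∈ B
      · simp [hB]
      · have : i ∈ T := by simpa [hB] using hi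
        simp [hB, hz i this]
    · intro y _ hy
      rw [if_neg]
      rintro ⟨h1, h2⟩
      apply hy
      funext i
      by_cases hB : i ∈ B
      · simp [hB, h2 i (Finset.mem_union_right _ hB)]
      · simp [hB, h1 i hB]
    · simp
  · rw [if_neg hz]
    refine Finset.sum_eq_zero fun y _ => if_neg ?_
    rintro ⟨h1, h2⟩
    apply hz
    intro i hi
    rw [h2 i (Finset.mem_union_left _ hi), h1 i (Finset.disjoint_left.mp hTB hi)]

/-- **Intersection axiom, semantic form; positivity is essential.** -/
theorem csi_intersection
    {p : ℕ} {d : Fin p → ℕ} (hd : ∀ i, 2 ≤ d i)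
    (f : Outcome d → ℝ) (hf : IsPositive f)
    (A B D S C : Finset (Fin p))
    (hAB : Disjoint A B) (hAD : Disjoint A D) (hAS : Disjoint A S) (hAC : Disjoint A C)
    (hBD : Disjoint B D) (hBS : Disjoint B S) (hBC : Disjoint B C)
    (hDS : Disjoint D S) (hDC : Disjoint D C) (hSC : Disjoint S C)
    (c : Outcome d)
    (h1 : CSI f A B (S ∪ D) C c) (h2 : CSI f A S (B ∪ D) C c) :
    CSI f A (B ∪ S) D C c := by
  have pos := margin_pos' f hf.1
  have key : ∀ y : Outcome d, (∀ i ∈ C, y i = c i) →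
      margin f (A ∪ (D ∪ C) ∪ B) y * margin f (S ∪ (D ∪ C)) y
        = margin f (A ∪ S ∪ (D ∪ C)) y * margin f (D ∪ C ∪ B) y := by
    intro y hy
    have a1 := h1 y hy
    have a2 := h2 y hy
    rw [show A ∪ B ∪ (S ∪ D) ∪ C = A ∪ B ∪ S ∪ D ∪ C by ext; simp <;> tauto,
      show S ∪ D ∪ C = S ∪ (D ∪ C) by ext; simp <;> tauto,
      show A ∪ (S ∪ D) ∪ C = A ∪ S ∪ (D ∪ C) by ext; simp <;> tauto,
      show B ∪ (S ∪ D) ∪ C = B ∪ S ∪ D ∪ C by ext; simp <;> tauto] at a1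
    rw [show A ∪ S ∪ (B ∪ D) ∪ C = A ∪ B ∪ S ∪ D ∪ C by ext; simp <;> tauto,
      show B ∪ D ∪ C = D ∪ C ∪ B by ext; simp <;> tauto,
      show A ∪ (B ∪ D) ∪ C = A ∪ (D ∪ C) ∪ B by ext; simp <;> tauto,
      show S ∪ (B ∪ D) ∪ C = B ∪ S ∪ D ∪ C by ext; simp <;> tauto] at a2
    apply mul_left_cancel₀ (pos (B ∪ S ∪ D ∪ C) y).ne'
    linear_combination margin f (D ∪ C ∪ B) y * a1 - margin f (S ∪ (D ∪ C)) y * a2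
  intro x hx
  have dE : Disjoint (D ∪ C) B := Finset.disjoint_union_left.mpr ⟨hBD.symm, hBC.symm⟩
  have dAE : Disjoint (A ∪ (D ∪ C)) B := Finset.disjoint_union_left.mpr ⟨hAB, dE⟩
  have dSE : Disjoint (S ∪ (D ∪ C)) B := Finset.disjoint_union_left.mpr ⟨hBS.symm, dE⟩
  have dASE : Disjoint (A ∪ S ∪ (D ∪ C)) B :=
    Finset.disjoint_union_left.mpr ⟨Finset.disjoint_union_left.mpr ⟨hAB, hBS.symm⟩, dE⟩
  have summed : margin f (A ∪ (D ∪ C)) x * margin f (S ∪ (D ∪ C)) x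
        = margin f (A ∪ S ∪ (D ∪ C)) x * margin f (D ∪ C) x := by
    rw [← sum_margin' f _ B dAE x, ← sum_margin' f _ B dE x, Finset.sum_mul, Finset.mul_sum]
    refine Finset.sum_congr rfl fun y _ => ?_
    by_cases h : ∀ i, i ∉ B → y i = x i
    · rw [if_pos h, if_pos h]
      have k := key y fun i hi => by
        rw [h i (Finset.disjoint_right.mp hBC hi), hx i hi]
      rwa [margin_congr' f (S ∪ (D ∪ C)) x y
          fun i hi => h i (Finset.disjoint_left.mp dSE hi),
        margin_congr' f (A ∪ S ∪ (D ∪ C)) x y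
          fun i hi => h i (Finset.disjoint_left.mp dASE hi)] at k
    · rw [if_neg h, if_neg h]; simp
  have a1 := h1 x hx
  rw [show A ∪ B ∪ (S ∪ D) ∪ C = A ∪ B ∪ S ∪ D ∪ C by ext; simp <;> tauto,
      show S ∪ D ∪ C = S ∪ (D ∪ C) by ext; simp <;> tauto,
      show A ∪ (S ∪ D) ∪ C = A ∪ S ∪ (D ∪ C) by ext; simp <;> tauto,
      show B ∪ (S ∪ D) ∪ C = B ∪ S ∪ D ∪ C by ext; simp <;> tauto] at a1
  rw [show A ∪ (B ∪ S) ∪ D ∪ C = A ∪ B ∪ S ∪ D ∪ C by ext; simp <;> tauto,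
    show A ∪ D ∪ C = A ∪ (D ∪ C) by ext; simp <;> tauto]
  apply mul_left_cancel₀ (pos (S ∪ (D ∪ C)) x).ne'
  linear_combination margin f (D ∪ C) x * a1 - margin f (B ∪ S ∪ D ∪ C) x * summed

end CStreeStmt7
end

section
/- (Maximum likelihood estimator of a CStree.) Let T be a CStree on p variables with causal order 1,...,p, and let u : R → ℕ be a contingency table with u(x) ≥ 1 for every x ∈ R. For x ∈ R and k ∈ [p], let C_{j(k,x)} ⊆ [k-1] be the context set of the stage-defining context of the unique stage of 𝒫_k containing x_{[k-1]}. Define p̂ : R → ℝ by p̂(x) = ∏_{k=1}^{p} u_{x, C_{j(k,x)} ∪ {k}} / u_{x, C_{j(k,x)}}. Then p̂ is a positive distribution lying in the CStree model M_T, and p̂ maximizes the likelihood over the model: for every f ∈ M_T, ∏_{x∈R} f(x)^{u(x)} ≤ ∏_{x∈R} p̂(x)^{u(x)}. -/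
open scoped Classical

namespace CStreeStmt10

variable {p : ℕ} {d : Fin p → ℕ}

/-- The outcome space `R = ∏ i, Fin (d i)`. -/
abbrev Outcome (d : Fin p → ℕ) := ∀ i : Fin p, Fin (d i)

/-- Marginal of `f` on the coordinates in `S`, evaluated at (the restriction of) `x`. -/
noncomputable def margin (f : Outcome d → ℝ) (S : Finset (Fin p)) (x : Outcome d) : ℝ :=
  ∑ y : Outcome d, if ∀ i ∈ S, y i = x i then f y else 0

/-- `f` is a (strictly) positive probability distribution on the outcome space. -/
def IsPositive (f : Outcome d → ℝ) : Prop :=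
  (∀ x, 0 < f x) ∧ ∑ x : Outcome d, f x = 1

/-- `f` entails the context-specific conditional independence relation
`X_A ⊥ X_B | X_S, X_C = c|_C`. -/
def CSI (f : Outcome d → ℝ) (A B S C : Finset (Fin p)) (c : Outcome d) : Prop :=
  ∀ x : Outcome d, (∀ i ∈ C, x i = c i) →
    margin f (A ∪ B ∪ S ∪ C) x * margin f (S ∪ C) x =
      margin f (A ∪ S ∪ C) x * margin f (B ∪ S ∪ C) x

/-- The conditional probability `f(a | y_{[k-1]})` of `X_k = a` given the first
`k-1` coordinates of `y`. -/
noncomputable def cond (f : Outcome d → ℝ) (k : Fin p) (a : Fin (d k)) (y : Outcome d) : ℝ :=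
  margin f (Finset.univ.filter (fun i => i ≤ k)) (Function.update y k a) /
    margin f (Finset.univ.filter (fun i => i < k)) y

/-- A CStree with causal order `1, …, p`: for each level `k`, a partition of the
outcomes of the first `k-1` variables (represented as cylinder subsets of the full
outcome space depending only on coordinates `< k`) into stages, each of which is a
cylinder set given by a context `(C, c)` with `C ⊆ [k-1]`. -/
structure CStree (p : ℕ) (d : Fin p → ℕ) where
  stages : Fin p → Finset (Set (Outcome d))
  isCylinder : ∀ k : Fin p, ∀ St ∈ stages k,
    ∃ (C : Finset (Fin p)) (c : Outcome d),
      (∀ i ∈ C, i < k) ∧ St = {y : Outcome d | ∀ i ∈ C, y i = c i}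
  partition : ∀ (k : Fin p) (x : Outcome d), ∃! St, St ∈ stages k ∧ x ∈ St

/-- The stage invariances defining a CStree model: within each stage, the
conditional distribution of the next variable is constant. -/
def StageInvariant (T : CStree p d) (f : Outcome d → ℝ) : Prop :=
  ∀ k : Fin p, ∀ St ∈ T.stages k, ∀ y ∈ St, ∀ y' ∈ St, ∀ a : Fin (d k),
    cond f k a y = cond f k a y'

/-- Membership in the CStree model `M_T`. -/
def MemModel (T : CStree p d) (f : Outcome d → ℝ) : Prop :=
  IsPositive f ∧ StageInvariant T f


/-- Marginal count `u_{x,S}` of the contingency table `u` over the coordinates in `S`. -/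
noncomputable def ucount (u : Outcome d → ℕ) (S : Finset (Fin p)) (x : Outcome d) : ℕ :=
  ∑ y : Outcome d, if ∀ i ∈ S, y i = x i then u y else 0

lemma margin_split (f : Outcome d → ℝ) (S : Finset (Fin p)) (k : Fin p) (hk : k ∉ S)
    (x : Outcome d) :
    margin f S x = ∑ a : Fin (d k), margin f (insert k S) (Function.update x k a) := by
  unfold margin
  rw [Finset.sum_comm]
  refine Finset.sum_congr rfl fun y _ => ?_
  have key : ∀ a : Fin (d k), (∀ i ∈ insert k S, y i = Function.update x k a i) ↔
      (y k = a ∧ ∀ i ∈ S, y i = x i) := by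
    intro a
    rw [Finset.forall_mem_insert, Function.update_self]
    refine and_congr Iff.rfl (forall₂_congr fun i hi => ?_)
    rw [Function.update_of_ne (by rintro rfl; exact hk hi)]
  simp only [key, ite_and]
  rw [Finset.sum_ite_eq]
  simp

def P (p n : ℕ) : Finset (Fin p) := Finset.univ.filter (fun i => i.val < n)

lemma mem_P {n : ℕ} {i : Fin p} : i ∈ P p n ↔ i.val < n := by simp [P]

lemma P_succ (k : Fin p) : P p (k.val + 1) = insert k (P p k.val) := by
  ext i
  simp only [mem_P, Finset.mem_insert, Fin.ext_iff]
  omega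

lemma filter_lt (k : Fin p) : Finset.univ.filter (fun i => i < k) = P p k.val := by
  ext i; rw [mem_P, Finset.mem_filter]; exact ⟨fun h => h.2, fun h => ⟨Finset.mem_univ _, h⟩⟩

lemma filter_le (k : Fin p) : Finset.univ.filter (fun i => i ≤ k) = P p (k.val + 1) := by
  ext i; rw [mem_P, Finset.mem_filter]
  exact ⟨fun h => Nat.lt_succ_of_le h.2, fun h => ⟨Finset.mem_univ _, Nat.le_of_lt_succ h⟩⟩

lemma P_zero : P p 0 = ∅ := by
  ext i; simp [mem_P]

lemma P_top : P p p = Finset.univ := by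
  ext i; simp [mem_P]

lemma not_mem_P (k : Fin p) : k ∉ P p k.val := by simp [mem_P]

lemma cond_eq (f : Outcome d → ℝ) (k : Fin p) (a : Fin (d k)) (y : Outcome d) :
    cond f k a y = margin f (P p (k.val + 1)) (Function.update y k a) /
      margin f (P p k.val) y := by
  rw [← filter_lt, ← filter_le]
  unfold cond
  congr!

lemma margin_univ (f : Outcome d → ℝ) (x : Outcome d) : margin f Finset.univ x = f x := by
  unfold margin
  have : ∀ y : Outcome d, (∀ i ∈ Finset.univ, y i = x i) ↔ y = x := by
    intro y; simp [funext_iff]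
  simp only [this]
  simp

lemma margin_empty (f : Outcome d → ℝ) (x : Outcome d) : margin f ∅ x = ∑ y, f y := by
  unfold margin
  simp

lemma margin_pos (f : Outcome d → ℝ) (hf : ∀ x, 0 < f x) (S : Finset (Fin p))
    (x : Outcome d) : 0 < margin f S x := by
  unfold margin
  refine Finset.sum_pos' (fun y _ => ?_) ⟨x, Finset.mem_univ _, ?_⟩
  · split_ifs
    · exact (hf y).le
    · exact le_rfl
  · simpa using hf x

lemma margin_congr (f : Outcome d → ℝ) (S : Finset (Fin p)) (x y : Outcome d)
    (h : ∀ i ∈ S, x i = y i) : margin f S x = margin f S y := by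
  unfold margin
  refine Finset.sum_congr rfl fun z _ => ?_
  have : (∀ i ∈ S, z i = x i) ↔ (∀ i ∈ S, z i = y i) :=
    forall₂_congr fun i hi => by rw [h i hi]
  simp only [this]

/-- marginals of a product of kernels -/
lemma margin_prod (c : ∀ k : Fin p, Fin (d k) → Outcome d → ℝ)
    (hc : ∀ k a x y, (∀ i, i < k → x i = y i) → c k a x = c k a y)
    (hs : ∀ k x, ∑ a, c k a x = 1) (F : Outcome d → ℝ)
    (hF : ∀ x, F x = ∏ k, c k (x k) x) (m : ℕ) :
    ∀ n, n + m = p → ∀ x, margin F (P p n) x = ∏ i ∈ P p n, c i (x i) x := by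
  induction m with
  | zero =>
    intro n hn x
    obtain rfl : n = p := by omega
    rw [P_top, margin_univ, hF]
  | succ m ih =>
    intro n hn x
    have ih' := ih (n + 1) (by omega)
    let k : Fin p := ⟨n, by omega⟩
    have hk : k.val = n := rfl
    rw [← hk] at ih' ⊢
    rw [P_succ] at ih'
    rw [margin_split F _ k (not_mem_P k)]
    have : ∀ a, margin F (insert k (P p k.val)) (Function.update x k a) =
        c k a x * ∏ i ∈ P p k.val, c i (x i) x := by
      intro a
      rw [ih', Finset.prod_insert (not_mem_P k), Function.update_self]
      congr 1
      · exact hc _ _ _ _ fun i hi => Function.update_of_ne hi.ne _ _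
      · refine Finset.prod_congr rfl fun i hi => ?_
        have hi' : i < k := mem_P.1 hi
        rw [Function.update_of_ne hi'.ne]
        exact hc _ _ _ _ fun j hj => Function.update_of_ne (hj.trans hi').ne _ _
    simp only [this]
    rw [← Finset.sum_mul, hs, one_mul]

lemma cond_prod (c : ∀ k : Fin p, Fin (d k) → Outcome d → ℝ)
    (hpos : ∀ k a x, 0 < c k a x)
    (hc : ∀ k a x y, (∀ i, i < k → x i = y i) → c k a x = c k a y)
    (hs : ∀ k x, ∑ a, c k a x = 1) (F : Outcome d → ℝ)
    (hF : ∀ x, F x = ∏ k, c k (x k) x) (k : Fin p) (a : Fin (d k)) (x : Outcome d) :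
    cond F k a x = c k a x := by
  have h1 : margin F (P p k.val) (Function.update x k a) = margin F (P p k.val) x :=
    margin_congr _ _ _ _ fun i hi => by
      have hi' : i < k := mem_P.1 hi
      exact Function.update_of_ne hi'.ne _ _
  rw [cond_eq, ← h1, margin_prod c hc hs F hF (p - (k.val + 1)) _ (by omega),
    margin_prod c hc hs F hF (p - k.val) _ (by omega), P_succ,
    Finset.prod_insert (not_mem_P k), Function.update_self,
    mul_div_cancel_right₀ _ (Finset.prod_pos fun i _ => hpos _ _ _).ne']
  exact hc _ _ _ _ fun i hi => Function.update_of_ne hi.ne _ _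

lemma telescoping (f : Outcome d → ℝ) (hf : IsPositive f) (x : Outcome d) (n : ℕ) :
    n ≤ p → margin f (P p n) x = ∏ i ∈ P p n, cond f i (x i) x := by
  induction n with
  | zero => intro _; rw [P_zero, margin_empty, hf.2, Finset.prod_empty]
  | succ n ih =>
    intro hn
    let k : Fin p := ⟨n, by omega⟩
    have hk : k.val = n := rfl
    have ih := ih (by omega)
    rw [← hk] at ih ⊢
    rw [P_succ, Finset.prod_insert (not_mem_P k), ← ih, cond_eq, Function.update_eq_self,
      div_mul_cancel₀ _ (margin_pos f hf.1 _ _).ne', P_succ]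

lemma cond_sum (f : Outcome d → ℝ) (hf : IsPositive f) (k : Fin p) (x : Outcome d) :
    ∑ a, cond f k a x = 1 := by
  simp only [cond_eq]
  rw [← Finset.sum_div, P_succ, ← margin_split f _ k (not_mem_P k),
    div_self (margin_pos f hf.1 _ _).ne']

lemma cond_pos (f : Outcome d → ℝ) (hf : IsPositive f) (k : Fin p) (a : Fin (d k))
    (x : Outcome d) : 0 < cond f k a x := by
  rw [cond_eq]
  exact div_pos (margin_pos f hf.1 _ _) (margin_pos f hf.1 _ _)

/-- counts over a stage, and over a stage with fixed next value -/
noncomputable def UU (u : Outcome d → ℕ) (E : Outcome d → Outcome d → Prop) (x : Outcome d) : ℝ :=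
  ∑ z, if E x z then (u z : ℝ) else 0

noncomputable def VV (u : Outcome d → ℕ) (E : Outcome d → Outcome d → Prop) (k : Fin p)
    (a : Fin (d k)) (x : Outcome d) : ℝ :=
  ∑ z, if E x z ∧ z k = a then (u z : ℝ) else 0

lemma sum_VV (u : Outcome d → ℕ) (E : Outcome d → Outcome d → Prop) (k : Fin p) (x : Outcome d) :
    ∑ a, VV u E k a x = UU u E x := by
  unfold VV UU
  rw [Finset.sum_comm]
  refine Finset.sum_congr rfl fun z _ => ?_
  by_cases h : E x z <;> simp [h]

lemma UU_pos (u : Outcome d → ℕ) (hu : ∀ x, 1 ≤ u x) (E : Outcome d → Outcome d → Prop)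
    (x : Outcome d) (h : E x x) : 0 < UU u E x := by
  unfold UU
  refine Finset.sum_pos' (fun y _ => ?_) ⟨x, Finset.mem_univ _, ?_⟩
  · split_ifs <;> positivity
  · have := hu x
    simp only [h, if_true]
    positivity

lemma VV_pos (u : Outcome d → ℕ) (hu : ∀ x, 1 ≤ u x) (E : Outcome d → Outcome d → Prop)
    (k : Fin p) (a : Fin (d k)) (x : Outcome d) (h : E x (Function.update x k a)) :
    0 < VV u E k a x := by
  unfold VV
  refine Finset.sum_pos' (fun y _ => ?_) ⟨Function.update x k a, Finset.mem_univ _, ?_⟩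
  · split_ifs <;> positivity
  · have := hu (Function.update x k a)
    simp only [h, Function.update_self, and_self, if_true]
    positivity

lemma level_sum (u : Outcome d → ℕ) (E : Outcome d → Outcome d → Prop) (hE : Equivalence E)
    (k : Fin p) (hV : ∀ a x, 0 < VV u E k a x)
    (h : Fin (d k) → Outcome d → ℝ)
    (hh : ∀ a x y, E x y → h a x = h a y) (hs : ∀ x, ∑ a, h a x = 1) :
    ∑ x, (u x : ℝ) * (h (x k) x / (VV u E k (x k) x / UU u E x)) = ∑ x, (u x : ℝ) := by
  have hVc : ∀ a x y, E x y → VV u E k a x = VV u E k a y := by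
    intro a x y hxy
    unfold VV
    refine Finset.sum_congr rfl fun z _ => ?_
    have : E x z ↔ E y z := ⟨fun t => hE.trans (hE.symm hxy) t, fun t => hE.trans hxy t⟩
    simp only [this]
  have h1 : ∀ x, (u x : ℝ) * (h (x k) x / (VV u E k (x k) x / UU u E x)) =
      ∑ z, if E x z then (u z : ℝ) * (u x * (h (x k) z / VV u E k (x k) z)) else 0 := by
    intro x
    have : ∀ z, (if E x z then (u z : ℝ) * (u x * (h (x k) z / VV u E k (x k) z)) else 0) =
        (if E x z then (u z : ℝ) else 0) * (u x * (h (x k) x / VV u E k (x k) x)) := by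
      intro z
      split_ifs with hz
      · rw [hh _ x z hz, hVc _ x z hz]
      · simp
    simp only [this]
    rw [← Finset.sum_mul]
    change _ = UU u E x * _
    rw [div_div_eq_mul_div]
    ring
  simp only [h1]
  rw [Finset.sum_comm]
  refine Finset.sum_congr rfl fun z _ => ?_
  have h2 : ∀ x, (if E x z then (u z : ℝ) * (u x * (h (x k) z / VV u E k (x k) z)) else 0) =
      ∑ a, (u z : ℝ) * (h a z / VV u E k a z) * (if E z x ∧ x k = a then (u x : ℝ) else 0) := by
    intro x
    have : E x z ↔ E z x := ⟨hE.symm, hE.symm⟩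
    simp only [this]
    by_cases hz : E z x
    · simp only [hz, true_and, if_true, mul_ite, mul_zero]
      rw [Finset.sum_ite_eq]
      simp only [Finset.mem_univ, if_true]
      ring
    · simp [hz]
  simp only [h2]
  rw [Finset.sum_comm]
  simp only [← Finset.mul_sum]
  change ∑ a, (u z : ℝ) * (h a z / VV u E k a z) * VV u E k a z = _
  have h3 : ∀ a, (u z : ℝ) * (h a z / VV u E k a z) * VV u E k a z = u z * h a z := by
    intro a
    rw [mul_assoc, div_mul_cancel₀ _ (hV a z).ne']
  simp only [h3]
  rw [← Finset.mul_sum, hs, mul_one]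

/-- **Maximum likelihood estimator of a CStree.** Given a CStree `T`
and a contingency table `u` with all entries positive, with `Ctx k x` a
stage-defining context set of the stage of level `k-1` containing `x_{[k-1]}`, the
estimator `p̂(x) = ∏ₖ u_{x, Ctx k x ∪ {k}} / u_{x, Ctx k x}` is a positive
distribution lying in the CStree model `M_T` and maximizes the likelihood over `M_T`. -/
theorem mle_formula
    (hd : ∀ i, 2 ≤ d i)
    (T : CStree p d) (u : Outcome d → ℕ) (hu : ∀ x, 1 ≤ u x)
    (Ctx : Fin p → Outcome d → Finset (Fin p))
    (hCtx : ∀ (k : Fin p) (x : Outcome d),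
      ∃ St ∈ T.stages k, x ∈ St ∧ (∀ i ∈ Ctx k x, i < k) ∧
        St = {y : Outcome d | ∀ i ∈ Ctx k x, y i = x i})
    (phat : Outcome d → ℝ)
    (hphat : ∀ x, phat x =
      ∏ k : Fin p, (ucount u (insert k (Ctx k x)) x : ℝ) / (ucount u (Ctx k x) x : ℝ)) :
    MemModel T phat ∧
      ∀ f : Outcome d → ℝ, MemModel T f →
        ∏ x : Outcome d, f x ^ u x ≤ ∏ x : Outcome d, phat x ^ u x := by
  set E : Fin p → Outcome d → Outcome d → Prop :=
    fun k x z => ∀ i ∈ Ctx k x, z i = x i with hEdef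
  have hEst : ∀ k x, ∀ St ∈ T.stages k, x ∈ St → ∀ z, E k x z ↔ z ∈ St := by
    intro k x St hSt hx z
    obtain ⟨St', h1, h2, h3, h4⟩ := hCtx k x
    have : St = St' := (T.partition k x).unique ⟨hSt, hx⟩ ⟨h1, h2⟩
    rw [this, h4]
    rfl
  have hlt : ∀ k x, ∀ i ∈ Ctx k x, i < k := by
    intro k x
    obtain ⟨St', h1, h2, h3, h4⟩ := hCtx k x
    exact h3
  have hE : ∀ k, Equivalence (E k) := by
    intro k
    refine ⟨fun x i _ => rfl, ?_, ?_⟩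
    · intro x y h
      obtain ⟨St, h1, h2, -⟩ := hCtx k x
      have hy := (hEst k x St h1 h2 y).1 h
      exact (hEst k y St h1 hy x).2 h2
    · intro x y z h h'
      obtain ⟨St, h1, h2, -⟩ := hCtx k x
      have hy := (hEst k x St h1 h2 y).1 h
      have hz := (hEst k y St h1 hy z).1 h'
      exact (hEst k x St h1 h2 z).2 hz
  have hEagree : ∀ k x y, (∀ i, i < k → x i = y i) → E k x y :=
    fun k x y h i hi => (h i (hlt k x i hi)).symm
  have hEupd : ∀ k x a, E k x (Function.update x k a) := fun k x a =>
    hEagree _ _ _ fun i hi => (Function.update_of_ne hi.ne _ _).symm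
  have hU : ∀ k x, 0 < UU u (E k) x := fun k x => UU_pos u hu _ x ((hE k).refl x)
  have hV : ∀ k a x, 0 < VV u (E k) k a x := fun k a x => VV_pos u hu _ k a x (hEupd k x a)
  set c : ∀ k : Fin p, Fin (d k) → Outcome d → ℝ :=
    fun k a x => VV u (E k) k a x / UU u (E k) x with hcdef
  have hcpos : ∀ k a x, 0 < c k a x := fun k a x => div_pos (hV k a x) (hU k x)
  have hcE : ∀ k a x y, E k x y → c k a x = c k a y := by
    intro k a x y hxy
    have : E k x = E k y := funext fun z => propext
      ⟨fun t => (hE k).trans ((hE k).symm hxy) t, fun t => (hE k).trans hxy t⟩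
    simp only [hcdef, VV, UU]
    rw [this]
  have hcs : ∀ k x, ∑ a, c k a x = 1 := by
    intro k x
    simp only [hcdef]
    rw [← Finset.sum_div, sum_VV, div_self (hU k x).ne']
  have hF : ∀ x, phat x = ∏ k, c k (x k) x := by
    intro x
    rw [hphat]
    refine Finset.prod_congr rfl fun k _ => ?_
    simp only [hcdef, VV, UU, ucount, hEdef]
    push_cast
    congr 1
    refine Finset.sum_congr rfl fun z _ => ?_
    have : (∀ i ∈ insert k (Ctx k x), z i = x i) ↔
        ((∀ i ∈ Ctx k x, z i = x i) ∧ z k = x k) := by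
      rw [Finset.forall_mem_insert, and_comm]
    simp only [this]
  have hcagree : ∀ k a x y, (∀ i, i < k → x i = y i) → c k a x = c k a y :=
    fun k a x y h => hcE k a x y (hEagree k x y h)
  have hcond := cond_prod c hcpos hcagree hcs phat hF
  have hppos : ∀ x, 0 < phat x := fun x => by
    rw [hF]; exact Finset.prod_pos fun k _ => hcpos _ _ _
  refine ⟨⟨⟨hppos, ?_⟩, ?_⟩, ?_⟩
  · let x0 : Outcome d := fun i => ⟨0, by have := hd i; omega⟩
    have := margin_prod c hcagree hcs phat hF p 0 (by omega) x0
    rwa [P_zero, margin_empty, Finset.prod_empty] at this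
  · intro k St hSt y hy y' hy' a
    rw [hcond, hcond]
    exact hcE k a y y' ((hEst k y St hSt hy y').2 hy')
  · intro f hf
    have hft : ∀ x, f x = ∏ k, cond f k (x k) x := by
      intro x
      have := telescoping f hf.1 x p le_rfl
      rwa [P_top, margin_univ] at this
    have hfE : ∀ k a x y, E k x y → cond f k a x = cond f k a y := by
      intro k a x y hxy
      obtain ⟨St, h1, h2, -⟩ := hCtx k x
      exact hf.2 k St h1 x h2 y ((hEst k x St h1 h2 y).1 hxy) a
    have hlevel : ∀ k, ∑ x, (u x : ℝ) * Real.log (cond f k (x k) x) ≤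
        ∑ x, (u x : ℝ) * Real.log (c k (x k) x) := by
      intro k
      have h1 := level_sum u (E k) (hE k) k (hV k) (cond f k) (hfE k) (cond_sum f hf.1 k)
      have h2 : ∀ x, (u x : ℝ) * Real.log (cond f k (x k) x) ≤
          (u x : ℝ) * Real.log (c k (x k) x) +
            ((u x : ℝ) * (cond f k (x k) x / c k (x k) x) - u x) := by
        intro x
        have ha := cond_pos f hf.1 k (x k) x
        have hb := hcpos k (x k) x
        have h3 := Real.log_le_sub_one_of_pos (div_pos ha hb)
        rw [Real.log_div ha.ne' hb.ne'] at h3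
        have h4 : (0 : ℝ) ≤ u x := Nat.cast_nonneg _
        nlinarith [mul_le_mul_of_nonneg_left h3 h4]
      have h5 := Finset.sum_le_sum fun x (_ : x ∈ Finset.univ) => h2 x
      rw [Finset.sum_add_distrib, Finset.sum_sub_distrib] at h5
      have h6 : ∑ x, (u x : ℝ) * (cond f k (x k) x / c k (x k) x) = ∑ x, (u x : ℝ) := h1
      linarith
    have hfpos := hf.1.1
    rw [← Real.log_le_log_iff (Finset.prod_pos fun x _ => pow_pos (hfpos x) _)
      (Finset.prod_pos fun x _ => pow_pos (hppos x) _),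
      Real.log_prod (fun x _ => (pow_pos (hfpos x) _).ne'),
      Real.log_prod (fun x _ => (pow_pos (hppos x) _).ne')]
    simp only [Real.log_pow]
    have e1 : ∀ x, Real.log (f x) = ∑ k, Real.log (cond f k (x k) x) := fun x => by
      rw [hft x, Real.log_prod (fun k _ => (cond_pos f hf.1 k (x k) x).ne')]
    have e2 : ∀ x, Real.log (phat x) = ∑ k, Real.log (c k (x k) x) := fun x => by
      rw [hF x, Real.log_prod (fun k _ => (hcpos k (x k) x).ne')]
    simp only [e1, e2, Finset.mul_sum]
    exact Finset.sum_comm.trans_le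
      ((Finset.sum_le_sum fun k _ => hlevel k).trans_eq Finset.sum_comm)

end CStreeStmt10
end

section
/- (Decomposability of the maximal log-likelihood of a CStree.) Let T be a CStree on p variables with causal order 1,...,p, and let u : R → ℕ be a contingency table with u(x) ≥ 1 for every x ∈ R. For k ∈ [p], a stage S_j ∈ 𝒫_k, and x_k ∈ Fin d_k, write u(S_j) = Σ_{x∈R : x_{[k-1]} ∈ S_j} u(x) and u(S_j, x_k) = Σ_{x∈R : x_{[k-1]} ∈ S_j and x has k-th coordinate x_k} u(x). Then the supremum over f ∈ M_T of the log-likelihood Σ_{x∈R} u(x)·log f(x) is attained (at the maximum likelihood estimator p̂) and equals Σ_{k=1}^{p} Σ_{S_j ∈ 𝒫_k} Σ_{x_k ∈ Fin d_k} u(S_j, x_k) · log( u(S_j, x_k) / u(S_j) ). -/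
open scoped Classical

namespace CStreeStmt11

variable {p : ℕ} {d : Fin p → ℕ}

/-- The outcome space `R = ∏ i, Fin (d i)`. -/
abbrev Outcome (d : Fin p → ℕ) := ∀ i : Fin p, Fin (d i)

/-- Marginal of `f` on the coordinates in `S`, evaluated at (the restriction of) `x`. -/
noncomputable def margin (f : Outcome d → ℝ) (S : Finset (Fin p)) (x : Outcome d) : ℝ :=
  ∑ y : Outcome d, if ∀ i ∈ S, y i = x i then f y else 0

/-- `f` is a (strictly) positive probability distribution on the outcome space. -/
def IsPositive (f : Outcome d → ℝ) : Prop :=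
  (∀ x, 0 < f x) ∧ ∑ x : Outcome d, f x = 1

/-- `f` entails the context-specific conditional independence relation
`X_A ⊥ X_B | X_S, X_C = c|_C`. -/
def CSI (f : Outcome d → ℝ) (A B S C : Finset (Fin p)) (c : Outcome d) : Prop :=
  ∀ x : Outcome d, (∀ i ∈ C, x i = c i) →
    margin f (A ∪ B ∪ S ∪ C) x * margin f (S ∪ C) x =
      margin f (A ∪ S ∪ C) x * margin f (B ∪ S ∪ C) x

/-- The conditional probability `f(a | y_{[k-1]})` of `X_k = a` given the first
`k-1` coordinates of `y`. -/
noncomputable def cond (f : Outcome d → ℝ) (k : Fin p) (a : Fin (d k)) (y : Outcome d) : ℝ :=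
  margin f (Finset.univ.filter (fun i => i ≤ k)) (Function.update y k a) /
    margin f (Finset.univ.filter (fun i => i < k)) y

/-- A CStree with causal order `1, …, p`: for each level `k`, a partition of the
outcomes of the first `k-1` variables (represented as cylinder subsets of the full
outcome space depending only on coordinates `< k`) into stages, each of which is a
cylinder set given by a context `(C, c)` with `C ⊆ [k-1]`. -/
structure CStree (p : ℕ) (d : Fin p → ℕ) where
  stages : Fin p → Finset (Set (Outcome d))
  isCylinder : ∀ k : Fin p, ∀ St ∈ stages k,
    ∃ (C : Finset (Fin p)) (c : Outcome d),
      (∀ i ∈ C, i < k) ∧ St = {y : Outcome d | ∀ i ∈ C, y i = c i}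
  partition : ∀ (k : Fin p) (x : Outcome d), ∃! St, St ∈ stages k ∧ x ∈ St

/-- The stage invariances defining a CStree model: within each stage, the
conditional distribution of the next variable is constant. -/
def StageInvariant (T : CStree p d) (f : Outcome d → ℝ) : Prop :=
  ∀ k : Fin p, ∀ St ∈ T.stages k, ∀ y ∈ St, ∀ y' ∈ St, ∀ a : Fin (d k),
    cond f k a y = cond f k a y'

/-- Membership in the CStree model `M_T`. -/
def MemModel (T : CStree p d) (f : Outcome d → ℝ) : Prop :=
  IsPositive f ∧ StageInvariant T f


noncomputable def MM (f : Outcome d → ℝ) (n : ℕ) (x : Outcome d) : ℝ :=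
  ∑ y : Outcome d, if ∀ i : Fin p, i.val < n → y i = x i then f y else 0

lemma cond_eq (f : Outcome d → ℝ) (k : Fin p) (a : Fin (d k)) (y : Outcome d) :
    cond f k a y = MM f (k.val + 1) (Function.update y k a) / MM f k.val y := by
  unfold cond margin MM
  congr 1
  · refine Finset.sum_congr rfl fun z _ => ?_
    refine if_congr ?_ rfl rfl
    simp only [Finset.mem_filter, Finset.mem_univ, true_and, Fin.le_def, Nat.lt_succ_iff]
  · refine Finset.sum_congr rfl fun z _ => ?_
    refine if_congr ?_ rfl rfl
    simp only [Finset.mem_filter, Finset.mem_univ, true_and, Fin.lt_def]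

lemma MM_step (f : Outcome d → ℝ) (k : Fin p) (x : Outcome d) :
    MM f k.val x = ∑ a : Fin (d k), MM f (k.val + 1) (Function.update x k a) := by
  unfold MM
  rw [Finset.sum_comm]
  refine Finset.sum_congr rfl fun y _ => ?_
  have key : ∀ a : Fin (d k), (∀ i : Fin p, i.val < k.val + 1 → y i = Function.update x k a i) ↔
      ((∀ i : Fin p, i.val < k.val → y i = x i) ∧ y k = a) := by
    intro a
    constructor
    · intro h
      refine ⟨fun i hi => ?_, ?_⟩
      · have := h i (by omega)
        rwa [Function.update_of_ne (by rintro rfl; omega)] at this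
      · have := h k (by omega)
        simpa using this
    · rintro ⟨h1, h2⟩ i hi
      by_cases hik : i = k
      · subst hik; simpa using h2
      · have : i.val ≠ k.val := fun h => hik (Fin.ext h)
        rw [Function.update_of_ne hik]
        exact h1 i (by omega)
  simp only [key]
  by_cases h : ∀ i : Fin p, i.val < k.val → y i = x i
  · simp only [eq_true h, true_and, if_true]
    simp
  · simp only [eq_false h, false_and, if_false]
    simp

lemma MM_top (f : Outcome d → ℝ) (x : Outcome d) : MM f p x = f x := by
  unfold MM
  have : ∀ y : Outcome d, (∀ i : Fin p, i.val < p → y i = x i) ↔ y = x := by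
    intro y
    constructor
    · intro h; funext i; exact h i i.2
    · rintro rfl i _; rfl
  simp only [this]
  simp

lemma MM_zero (f : Outcome d → ℝ) (x : Outcome d) : MM f 0 x = ∑ y, f y := by
  simp [MM]

lemma MM_pos (f : Outcome d → ℝ) (hf : ∀ x, 0 < f x) (n : ℕ) (x : Outcome d) : 0 < MM f n x := by
  unfold MM
  refine Finset.sum_pos' (fun y _ => ?_) ⟨x, Finset.mem_univ _, ?_⟩
  · split_ifs
    · exact (hf y).le
    · exact le_rfl
  · simpa using hf x

lemma cond_pos (f : Outcome d → ℝ) (hf : ∀ x, 0 < f x) (k : Fin p) (a : Fin (d k))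
    (y : Outcome d) : 0 < cond f k a y := by
  rw [cond_eq]; exact div_pos (MM_pos f hf _ _) (MM_pos f hf _ _)

lemma cond_sum (f : Outcome d → ℝ) (hf : ∀ x, 0 < f x) (k : Fin p)
    (y : Outcome d) : ∑ a, cond f k a y = 1 := by
  simp only [cond_eq]
  rw [← Finset.sum_div, ← MM_step, div_self (MM_pos f hf _ _).ne']

lemma filt_succ (k : Fin p) : (Finset.univ.filter fun i : Fin p => i.val < k.val + 1) =
    insert k (Finset.univ.filter fun i : Fin p => i.val < k.val) := by
  ext i
  simp only [Finset.mem_filter, Finset.mem_univ, true_and, Finset.mem_insert, Fin.ext_iff]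
  omega

lemma MM_prod (f : Outcome d → ℝ) (hf : IsPositive f) (x : Outcome d) (n : ℕ) (hn : n ≤ p) :
    MM f n x = ∏ k ∈ Finset.univ.filter (fun i : Fin p => i.val < n), cond f k (x k) x := by
  induction n with
  | zero => simp [MM_zero, hf.2]
  | succ n ih =>
    have h := ih (by omega)
    have hs := filt_succ (⟨n, hn⟩ : Fin p)
    simp only at hs
    rw [hs, Finset.prod_insert (by simp), ← h, cond_eq]
    simp only [Function.update_eq_self]
    rw [div_mul_cancel₀ _ (MM_pos f hf.1 _ _).ne']

lemma log_eq (f : Outcome d → ℝ) (hf : IsPositive f) (x : Outcome d) :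
    Real.log (f x) = ∑ k : Fin p, Real.log (cond f k (x k) x) := by
  have h := MM_prod f hf x p le_rfl
  rw [MM_top] at h
  rw [h, Finset.filter_true_of_mem (fun i _ => i.2), Real.log_prod]
  intro k _
  exact (cond_pos f hf.1 _ _ _).ne'

lemma MM_of_prod (g : Fin p → Outcome d → ℝ)
    (hg : ∀ k x y, (∀ i : Fin p, i ≤ k → x i = y i) → g k x = g k y)
    (hs : ∀ k x, ∑ a, g k (Function.update x k a) = 1) (m : ℕ) :
    ∀ n, n + m = p → ∀ x, MM (fun x => ∏ k, g k x) n x =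
      ∏ k ∈ Finset.univ.filter (fun i : Fin p => i.val < n), g k x := by
  induction m with
  | zero =>
    intro n hn x
    obtain rfl : n = p := by omega
    rw [MM_top, Finset.filter_true_of_mem (fun i _ => i.2)]
  | succ m ih =>
    intro n hn x
    have h := MM_step (fun x => ∏ k, g k x) (⟨n, by omega⟩ : Fin p) x
    simp only at h
    rw [h]
    have hs' := filt_succ (⟨n, by omega⟩ : Fin p)
    simp only at hs'
    have : ∀ a : Fin (d ⟨n, by omega⟩), MM (fun x => ∏ k, g k x) (n + 1) (Function.update x (⟨n, by omega⟩ : Fin p) a) =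
        g ⟨n, by omega⟩ (Function.update x (⟨n, by omega⟩ : Fin p) a) *
        ∏ k ∈ Finset.univ.filter (fun i : Fin p => i.val < n), g k x := by
      intro a
      rw [ih (n + 1) (by omega), hs', Finset.prod_insert (by simp)]
      congr 1
      refine Finset.prod_congr rfl fun k hk => hg _ _ _ fun i hi => ?_
      rw [Finset.mem_filter] at hk
      rw [Function.update_of_ne]
      rintro rfl
      have := Fin.le_def.1 hi
      simp only at this
      omega
    simp only [this]
    rw [← Finset.sum_mul, hs, one_mul]

lemma gibbs {ι : Type*} [Fintype ι] (v c : ι → ℝ) (hv : ∀ a, 0 < v a) (hc : ∀ a, 0 < c a)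
    (V : ℝ) (hV : 0 < V) (hvs : ∑ a, v a = V) (hcs : ∑ a, c a = 1) :
    ∑ a, v a * Real.log (c a) ≤ ∑ a, v a * Real.log (v a / V) := by
  have h : ∀ a, v a * Real.log (c a) - v a * Real.log (v a / V) ≤ c a * V - v a := by
    intro a
    have h1 := Real.log_le_sub_one_of_pos (div_pos (hc a) (div_pos (hv a) hV))
    rw [Real.log_div (hc a).ne' (div_pos (hv a) hV).ne'] at h1
    have h2 := mul_le_mul_of_nonneg_left h1 (hv a).le
    have h3 : v a * (c a / (v a / V) - 1) = c a * V - v a := by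
      have := (hv a).ne'
      field_simp
    linarith
  have h2 := Finset.sum_le_sum (fun a (_ : a ∈ Finset.univ) => h a)
  rw [Finset.sum_sub_distrib, Finset.sum_sub_distrib, ← Finset.sum_mul, hcs, hvs] at h2
  linarith

lemma regroup (T : CStree p d) (k : Fin p) (F : Outcome d → ℝ) :
    ∑ x, F x = ∑ St ∈ T.stages k, ∑ a : Fin (d k), ∑ x, if x ∈ St ∧ x k = a then F x else 0 := by
  have h1 : ∀ St : Set (Outcome d),
      (∑ a : Fin (d k), ∑ x : Outcome d, if x ∈ St ∧ x k = a then F x else 0) =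
      ∑ x, if x ∈ St then F x else 0 := by
    intro St
    rw [Finset.sum_comm]
    refine Finset.sum_congr rfl fun x _ => ?_
    by_cases h : x ∈ St <;> simp [h]
  simp only [h1]
  rw [Finset.sum_comm]
  refine Finset.sum_congr rfl fun x _ => ?_
  obtain ⟨S, ⟨hS, hx⟩, hu⟩ := T.partition k x
  rw [Finset.sum_eq_single S]
  · simp [hx]
  · intro S' hS' hne
    rw [if_neg]
    intro h
    exact hne (hu S' ⟨hS', h⟩)
  · intro h; exact absurd hS h

lemma loglik_eq (T : CStree p d) (w : Outcome d → ℝ) (rep : Set (Outcome d) → Outcome d)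
    (hrep : ∀ k, ∀ St ∈ T.stages k, rep St ∈ St) (f : Outcome d → ℝ) (hf : MemModel T f) :
    ∑ x, w x * Real.log (f x) = ∑ k : Fin p, ∑ St ∈ T.stages k, ∑ a : Fin (d k),
      (∑ x : Outcome d, if x ∈ St ∧ x k = a then w x else 0) *
        Real.log (cond f k a (rep St)) := by
  simp only [log_eq f hf.1, Finset.mul_sum]
  rw [Finset.sum_comm]
  refine Finset.sum_congr rfl fun k _ => ?_
  rw [regroup T k]
  refine Finset.sum_congr rfl fun St hSt => Finset.sum_congr rfl fun a _ => ?_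
  rw [Finset.sum_mul]
  refine Finset.sum_congr rfl fun x _ => ?_
  split_ifs with h
  · rw [hf.2 k St hSt x h.1 (rep St) (hrep k St hSt), h.2]
  · simp

lemma stage_congr (T : CStree p d) (k : Fin p) (St : Set (Outcome d)) (hSt : St ∈ T.stages k)
    (x y : Outcome d) (hx : x ∈ St) (h : ∀ i, i < k → x i = y i) : y ∈ St := by
  obtain ⟨C, c, hC, rfl⟩ := T.isCylinder k St hSt
  intro i hi
  rw [← h i (hC i hi)]
  exact hx i hi

/-- **Decomposability of the maximal log-likelihood of a CStree.**
The supremum over `f ∈ M_T` of the log-likelihood `∑ₓ u(x) log f(x)` is attained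
(at the maximum likelihood estimator) and equals the sum over levels `k`, stages
`St` of level `k-1`, and values `a` of `X_k` of `u(St, a) · log (u(St, a) / u(St))`. -/
theorem loglik_decomposition
    (hd : ∀ i, 2 ≤ d i)
    (T : CStree p d) (u : Outcome d → ℕ) (hu : ∀ x, 1 ≤ u x) :
    ∃ fhat : Outcome d → ℝ, MemModel T fhat ∧
      (∀ f : Outcome d → ℝ, MemModel T f →
        ∑ x : Outcome d, (u x : ℝ) * Real.log (f x) ≤
          ∑ x : Outcome d, (u x : ℝ) * Real.log (fhat x)) ∧
      ∑ x : Outcome d, (u x : ℝ) * Real.log (fhat x)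
        = ∑ k : Fin p, ∑ St ∈ T.stages k, ∑ a : Fin (d k),
            (∑ x : Outcome d, if x ∈ St ∧ x k = a then (u x : ℝ) else 0) *
              Real.log ((∑ x : Outcome d, if x ∈ St ∧ x k = a then (u x : ℝ) else 0) /
                (∑ x : Outcome d, if x ∈ St then (u x : ℝ) else 0)) := by
  have hw : ∀ x, (0 : ℝ) < u x := fun x => by exact_mod_cast hu x
  generalize hwe : (fun x => (u x : ℝ)) = w
  have hwe' : ∀ x, (u x : ℝ) = w x := fun x => congrFun hwe x
  simp only [hwe'] at hw ⊢
  have hne : ∀ St : Set (Outcome d), ∃ r : Outcome d, ∀ k, St ∈ T.stages k → r ∈ St := by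
    intro St
    by_cases h : St.Nonempty
    · obtain ⟨r, hr⟩ := h
      exact ⟨r, fun _ _ => hr⟩
    · refine ⟨fun i => ⟨0, by have := hd i; omega⟩, fun k hk => ?_⟩
      obtain ⟨C, c, -, rfl⟩ := T.isCylinder k St hk
      exact absurd ⟨c, fun i _ => rfl⟩ h
  choose rep hrep' using hne
  have hrep : ∀ k, ∀ St ∈ T.stages k, rep St ∈ St := fun k St h => hrep' St k h
  set U : Set (Outcome d) → ℝ := fun St => ∑ x : Outcome d, if x ∈ St then w x else 0 with hU
  set V : (k : Fin p) → Set (Outcome d) → Fin (d k) → ℝ := fun k St a =>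
    ∑ x : Outcome d, if x ∈ St ∧ x k = a then w x else 0 with hV
  have hVpos : ∀ k, ∀ St ∈ T.stages k, ∀ a, 0 < V k St a := by
    intro k St hSt a
    refine Finset.sum_pos' (fun y _ => ?_) ⟨Function.update (rep St) k a, Finset.mem_univ _, ?_⟩
    · split_ifs
      · exact (hw y).le
      · exact le_rfl
    · rw [if_pos]
      · exact hw _
      · refine ⟨stage_congr T k St hSt _ _ (hrep k St hSt) fun i hi => ?_, by simp⟩
        rw [Function.update_of_ne hi.ne]
  have hUpos : ∀ k, ∀ St ∈ T.stages k, 0 < U St := by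
    intro k St hSt
    refine Finset.sum_pos' (fun y _ => ?_) ⟨rep St, Finset.mem_univ _, ?_⟩
    · split_ifs
      · exact (hw y).le
      · exact le_rfl
    · rw [if_pos (hrep k St hSt)]
      exact hw _
  have hVU : ∀ k St, ∑ a, V k St a = U St := by
    intro k St
    simp only [hV, hU]
    rw [Finset.sum_comm]
    refine Finset.sum_congr rfl fun x _ => ?_
    by_cases h : x ∈ St <;> simp [h]
  choose s hs hsu using T.partition
  have hscongr : ∀ k x y, (∀ i, i < k → x i = y i) → s k x = s k y := by
    intro k x y h
    exact hsu k y _ ⟨(hs k x).1, stage_congr T k _ (hs k x).1 x y (hs k x).2 h⟩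
  set g : Fin p → Outcome d → ℝ := fun k x => V k (s k x) (x k) / U (s k x) with hg
  have hgpos : ∀ k x, 0 < g k x := fun k x =>
    div_pos (hVpos k _ (hs k x).1 _) (hUpos k _ (hs k x).1)
  have hgc : ∀ k x y, (∀ i : Fin p, i ≤ k → x i = y i) → g k x = g k y := by
    intro k x y h
    simp only [hg]
    rw [hscongr k x y fun i hi => h i hi.le, h k le_rfl]
  have hgu : ∀ k x a, g k (Function.update x k a) = V k (s k x) a / U (s k x) := by
    intro k x a
    simp only [hg]
    rw [hscongr k (Function.update x k a) x fun i hi => Function.update_of_ne hi.ne _ _]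
    simp
  have hgs : ∀ k x, ∑ a, g k (Function.update x k a) = 1 := by
    intro k x
    simp only [hgu]
    rw [← Finset.sum_div, hVU, div_self (hUpos k _ (hs k x).1).ne']
  have hM : ∀ n, n ≤ p → ∀ x, MM (fun x => ∏ k, g k x) n x =
      ∏ k ∈ Finset.univ.filter (fun i : Fin p => i.val < n), g k x := fun n hn =>
    MM_of_prod g hgc hgs (p - n) n (by omega)
  have hpos : IsPositive (fun x => ∏ k, g k x) := by
    refine ⟨fun x => Finset.prod_pos fun k _ => hgpos k x, ?_⟩
    have := hM 0 (by omega) (rep ∅)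
    rw [MM_zero] at this
    simpa using this
  have hcond : ∀ k, ∀ St ∈ T.stages k, ∀ y ∈ St, ∀ a,
      cond (fun x => ∏ k, g k x) k a y = V k St a / U St := by
    intro k St hSt y hy a
    have hy' : s k y = St := (hsu k y St ⟨hSt, hy⟩).symm
    rw [cond_eq, hM _ (by omega), hM _ (by omega), filt_succ, Finset.prod_insert (by simp), hgu, hy']
    have : ∏ i ∈ Finset.univ.filter (fun i : Fin p => i.val < k.val), g i (Function.update y k a) =
        ∏ i ∈ Finset.univ.filter (fun i : Fin p => i.val < k.val), g i y := by
      refine Finset.prod_congr rfl fun i hi => hgc _ _ _ fun j hj => ?_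
      rw [Finset.mem_filter] at hi
      rw [Function.update_of_ne]
      rintro rfl
      have := Fin.le_def.1 hj
      omega
    rw [this, mul_div_cancel_right₀]
    exact (Finset.prod_pos fun i _ => hgpos i y).ne'
  have hmem : MemModel T (fun x => ∏ k, g k x) := by
    refine ⟨hpos, fun k St hSt y hy y' hy' a => ?_⟩
    rw [hcond k St hSt y hy, hcond k St hSt y' hy']
  have heq : ∑ x : Outcome d, w x * Real.log (∏ k, g k x) =
      ∑ k : Fin p, ∑ St ∈ T.stages k, ∑ a : Fin (d k),
        V k St a * Real.log (V k St a / U St) := by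
    rw [loglik_eq T w rep hrep _ hmem]
    refine Finset.sum_congr rfl fun k _ => Finset.sum_congr rfl fun St hSt =>
      Finset.sum_congr rfl fun a _ => ?_
    rw [hcond k St hSt _ (hrep k St hSt)]
  refine ⟨fun x => ∏ k, g k x, hmem, fun f hf => ?_, heq⟩
  rw [heq, loglik_eq T w rep hrep f hf]
  refine Finset.sum_le_sum fun k _ => Finset.sum_le_sum fun St hSt => ?_
  exact gibbs (V k St) (fun a => cond f k a (rep St)) (hVpos k St hSt)
    (fun a => cond_pos f hf.1.1 k a _) (U St) (hUpos k St hSt) (hVU k St)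
    (cond_sum f hf.1.1 k _)

end CStreeStmt11
end

section
/- (Constancy of stage conditionals of the MLE.) Let T be a CStree on p variables with causal order 1,...,p, and let u : R → ℕ be a contingency table with u(x) ≥ 1 for every x ∈ R. Let p̂ be the maximum likelihood estimator p̂(x) = ∏_{k=1}^{p} u_{x, C_{j(k,x)} ∪ {k}} / u_{x, C_{j(k,x)}}, where C_{j(k,x)} is the context set of the stage of 𝒫_k containing x_{[k-1]}. Then for every k ∈ [p] and every x ∈ R, the conditional probability of the MLE satisfies p̂(x_k | x_{[k-1]}) = u_{x, C_{j(k,x)} ∪ {k}} / u_{x, C_{j(k,x)}}; in particular, this conditional probability is the same for all x' ∈ R with x'_{[k-1]} in the same stage as x_{[k-1]} and with the same k-th coordinate, so p̂ satisfies all the stage invariances defining M_T. -/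
open scoped Classical

namespace CStreeStmt14

variable {p : ℕ} {d : Fin p → ℕ}

/-- The outcome space `R = ∏ i, Fin (d i)`. -/
abbrev Outcome (d : Fin p → ℕ) := ∀ i : Fin p, Fin (d i)

/-- Marginal of `f` on the coordinates in `S`, evaluated at (the restriction of) `x`. -/
noncomputable def margin (f : Outcome d → ℝ) (S : Finset (Fin p)) (x : Outcome d) : ℝ :=
  ∑ y : Outcome d, if ∀ i ∈ S, y i = x i then f y else 0

/-- `f` is a (strictly) positive probability distribution on the outcome space. -/
def IsPositive (f : Outcome d → ℝ) : Prop :=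
  (∀ x, 0 < f x) ∧ ∑ x : Outcome d, f x = 1

/-- `f` entails the context-specific conditional independence relation
`X_A ⊥ X_B | X_S, X_C = c|_C`. -/
def CSI (f : Outcome d → ℝ) (A B S C : Finset (Fin p)) (c : Outcome d) : Prop :=
  ∀ x : Outcome d, (∀ i ∈ C, x i = c i) →
    margin f (A ∪ B ∪ S ∪ C) x * margin f (S ∪ C) x =
      margin f (A ∪ S ∪ C) x * margin f (B ∪ S ∪ C) x

/-- The conditional probability `f(a | y_{[k-1]})` of `X_k = a` given the first
`k-1` coordinates of `y`. -/
noncomputable def cond (f : Outcome d → ℝ) (k : Fin p) (a : Fin (d k)) (y : Outcome d) : ℝ :=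
  margin f (Finset.univ.filter (fun i => i ≤ k)) (Function.update y k a) /
    margin f (Finset.univ.filter (fun i => i < k)) y

/-- A CStree with causal order `1, …, p`: for each level `k`, a partition of the
outcomes of the first `k-1` variables (represented as cylinder subsets of the full
outcome space depending only on coordinates `< k`) into stages, each of which is a
cylinder set given by a context `(C, c)` with `C ⊆ [k-1]`. -/
structure CStree (p : ℕ) (d : Fin p → ℕ) where
  stages : Fin p → Finset (Set (Outcome d))
  isCylinder : ∀ k : Fin p, ∀ St ∈ stages k,
    ∃ (C : Finset (Fin p)) (c : Outcome d),
      (∀ i ∈ C, i < k) ∧ St = {y : Outcome d | ∀ i ∈ C, y i = c i}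
  partition : ∀ (k : Fin p) (x : Outcome d), ∃! St, St ∈ stages k ∧ x ∈ St

/-- The stage invariances defining a CStree model: within each stage, the
conditional distribution of the next variable is constant. -/
def StageInvariant (T : CStree p d) (f : Outcome d → ℝ) : Prop :=
  ∀ k : Fin p, ∀ St ∈ T.stages k, ∀ y ∈ St, ∀ y' ∈ St, ∀ a : Fin (d k),
    cond f k a y = cond f k a y'

/-- Membership in the CStree model `M_T`. -/
def MemModel (T : CStree p d) (f : Outcome d → ℝ) : Prop :=
  IsPositive f ∧ StageInvariant T f


/-- Marginal count `u_{x,S}` of the contingency table `u` over the coordinates in `S`. -/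
noncomputable def ucount (u : Outcome d → ℕ) (S : Finset (Fin p)) (x : Outcome d) : ℕ :=
  ∑ y : Outcome d, if ∀ i ∈ S, y i = x i then u y else 0

lemma ucount_cast (u : Outcome d → ℕ) (S : Finset (Fin p)) (x : Outcome d) :
    (ucount u S x : ℝ) = margin (fun y => (u y : ℝ)) S x := by
  simp [ucount, margin]

lemma margin_pos' (f : Outcome d → ℝ) (hf : ∀ x, 0 < f x) (S : Finset (Fin p)) (x : Outcome d) :
    0 < margin f S x := by
  unfold margin
  apply Finset.sum_pos'
  · intro i _
    split_ifs
    · exact (hf i).le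
    · exact le_rfl
  · exact ⟨x, Finset.mem_univ _, by simpa using hf x⟩

lemma margin_congr' (f : Outcome d → ℝ) (S S' : Finset (Fin p)) (x x' : Outcome d)
    (h : ∀ y : Outcome d, (∀ i ∈ S, y i = x i) ↔ (∀ i ∈ S', y i = x' i)) :
    margin f S x = margin f S' x' := by
  unfold margin
  refine Finset.sum_congr rfl fun y _ => ?_
  simp only [h y]

lemma margin_split (f : Outcome d → ℝ) (S : Finset (Fin p)) (k : Fin p) (hk : k ∉ S)
    (x : Outcome d) :
    ∑ a : Fin (d k), margin f (insert k S) (Function.update x k a) = margin f S x := by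
  unfold margin
  rw [Finset.sum_comm]
  refine Finset.sum_congr rfl fun y _ => ?_
  have h : ∀ a : Fin (d k), (∀ i ∈ insert k S, y i = Function.update x k a i) ↔
      (y k = a ∧ ∀ i ∈ S, y i = x i) := by
    intro a
    rw [Finset.forall_mem_insert, Function.update_self]
    refine and_congr_right fun _ => forall₂_congr fun i hi => ?_
    have hne : i ≠ k := by
      rintro rfl
      exact hk hi
    rw [Function.update_of_ne hne]
  rw [Finset.sum_congr rfl (fun a _ => if_congr (h a) rfl rfl)]
  by_cases hy : ∀ i ∈ S, y i = x i
  · rw [if_pos hy, Finset.sum_eq_single (y k)]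
    · rw [if_pos ⟨rfl, hy⟩]
    · intro b _ hb
      rw [if_neg fun h => hb h.1.symm]
    · intro h
      exact absurd (Finset.mem_univ _) h
  · rw [if_neg hy]
    exact Finset.sum_eq_zero fun a _ => if_neg fun h => hy h.2

lemma margin_prod (r : Fin p → Outcome d → ℝ)
    (hloc : ∀ k x y, (∀ i, i ≤ k → y i = x i) → r k y = r k x)
    (hsum : ∀ k x, ∑ a : Fin (d k), r k (Function.update x k a) = 1)
    (f : Outcome d → ℝ) (hf : ∀ x, f x = ∏ k, r k x) (n m : ℕ) (hnm : n + m = p)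
    (x : Outcome d) :
    margin f (Finset.univ.filter (fun i : Fin p => i.val < m)) x =
      ∏ k ∈ Finset.univ.filter (fun i : Fin p => i.val < m), r k x := by
  induction n generalizing m x with
  | zero =>
    have hm : m = p := by omega
    subst hm
    have : (Finset.univ.filter (fun i : Fin m => i.val < m)) = Finset.univ := by
      ext i; simp
    rw [this, ← hf]
    unfold margin
    rw [Finset.sum_eq_single x]
    · simp
    · intro y _ hy
      rw [if_neg]
      intro h
      exact hy (funext fun i => h i (Finset.mem_univ _))
    · simp
  | succ n ih =>
    have hmp : m < p := by omega
    have hins : (Finset.univ.filter (fun i : Fin p => i.val < m + 1)) =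
        insert (⟨m, hmp⟩ : Fin p) (Finset.univ.filter (fun i : Fin p => i.val < m)) := by
      ext i
      simp [Fin.ext_iff]
      omega
    have hnot : (⟨m, hmp⟩ : Fin p) ∉ Finset.univ.filter (fun i : Fin p => i.val < m) := by simp
    rw [← margin_split f _ _ hnot, ← hins]
    have key : ∀ a : Fin (d ⟨m, hmp⟩),
        margin f (Finset.univ.filter (fun i : Fin p => i.val < m + 1))
          (Function.update x ⟨m, hmp⟩ a) =
        r ⟨m, hmp⟩ (Function.update x ⟨m, hmp⟩ a) *
          ∏ k ∈ Finset.univ.filter (fun i : Fin p => i.val < m), r k x := by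
      intro a
      rw [ih (m + 1) (by omega), hins, Finset.prod_insert hnot]
      congr 1
      refine Finset.prod_congr rfl fun k hk => hloc _ _ _ fun i hi => ?_
      apply Function.update_of_ne
      have h1 : k.val < m := by simpa using hk
      have h2 : i.val ≤ k.val := hi
      intro e
      have h3 : i.val = m := congrArg Fin.val e
      omega
    rw [Finset.sum_congr rfl (fun a _ => key a), ← Finset.sum_mul, hsum, one_mul]

/-- **Constancy of stage conditionals of the MLE.** The conditional
probabilities of the maximum likelihood estimator `p̂` are given by the marginal
count ratios `u_{x, Ctx k x ∪ {k}} / u_{x, Ctx k x}`; in particular they are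
constant across each stage, so `p̂` satisfies all the stage invariances defining
the CStree model `M_T`. -/
theorem mle_cond_constant
    (hd : ∀ i, 2 ≤ d i)
    (T : CStree p d) (u : Outcome d → ℕ) (hu : ∀ x, 1 ≤ u x)
    (Ctx : Fin p → Outcome d → Finset (Fin p))
    (hCtx : ∀ (k : Fin p) (x : Outcome d),
      ∃ St ∈ T.stages k, x ∈ St ∧ (∀ i ∈ Ctx k x, i < k) ∧
        St = {y : Outcome d | ∀ i ∈ Ctx k x, y i = x i})
    (phat : Outcome d → ℝ)
    (hphat : ∀ x, phat x =
      ∏ k : Fin p, (ucount u (insert k (Ctx k x)) x : ℝ) / (ucount u (Ctx k x) x : ℝ)) :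
    (∀ (k : Fin p) (x : Outcome d),
        cond phat k (x k) x =
          (ucount u (insert k (Ctx k x)) x : ℝ) / (ucount u (Ctx k x) x : ℝ)) ∧
      StageInvariant T phat := by
  have hstage : ∀ (k : Fin p) (St : Set (Outcome d)), St ∈ T.stages k → ∀ x ∈ St,
      (∀ i ∈ Ctx k x, i < k) ∧ ∀ y, y ∈ St ↔ ∀ i ∈ Ctx k x, y i = x i := by
    intro k St hSt x hx
    obtain ⟨St', h1, h2, h3, h4⟩ := hCtx k x
    have : St = St' := (T.partition k x).unique ⟨hSt, hx⟩ ⟨h1, h2⟩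
    subst this
    refine ⟨h3, fun y => ?_⟩
    conv_lhs => rw [h4]
    rfl
  have hlt : ∀ k x, ∀ i ∈ Ctx k x, i < k := by
    intro k x
    obtain ⟨St', h1, h2, h3, h4⟩ := hCtx k x
    exact h3
  have hmem : ∀ (k : Fin p) (St : Set (Outcome d)), St ∈ T.stages k → ∀ x ∈ St, ∀ y,
      (∀ i, i < k → y i = x i) → y ∈ St := by
    intro k St hSt x hx y hy
    obtain ⟨h1, h2⟩ := hstage k St hSt x hx
    exact (h2 y).2 fun i hi => hy i (h1 i hi)
  set r : Fin p → Outcome d → ℝ := fun k x =>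
    (ucount u (insert k (Ctx k x)) x : ℝ) / (ucount u (Ctx k x) x : ℝ) with hr
  have hupos : ∀ S x, 0 < margin (fun y => (u y : ℝ)) S x :=
    margin_pos' _ (fun x => by exact_mod_cast hu x)
  have hrpos : ∀ k x, 0 < r k x := by
    intro k x
    simp only [hr, ucount_cast]
    exact div_pos (hupos _ _) (hupos _ _)
  have hSt : ∀ (k : Fin p) (St : Set (Outcome d)), St ∈ T.stages k → ∀ x ∈ St, ∀ y ∈ St,
      margin (fun y => (u y : ℝ)) (Ctx k x) x = margin (fun y => (u y : ℝ)) (Ctx k y) y ∧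
      (x k = y k → r k x = r k y) := by
    intro k St hS x hx y hy
    obtain ⟨h1, h2⟩ := hstage k St hS x hx
    obtain ⟨h3, h4⟩ := hstage k St hS y hy
    have e : margin (fun y => (u y : ℝ)) (Ctx k x) x = margin (fun y => (u y : ℝ)) (Ctx k y) y :=
      margin_congr' _ _ _ _ _ fun z => (h2 z).symm.trans (h4 z)
    refine ⟨e, fun hxy => ?_⟩
    simp only [hr, ucount_cast]
    rw [e]
    congr 1
    apply margin_congr'
    intro z
    rw [Finset.forall_mem_insert, Finset.forall_mem_insert, ← h2, ← h4, hxy]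
  have hloc : ∀ k x y, (∀ i, i ≤ k → y i = x i) → r k y = r k x := by
    intro k x y h
    obtain ⟨St, hS, hx, -⟩ := hCtx k x
    exact (hSt k St hS y (hmem k St hS x hx y fun i hi => h i hi.le) x hx).2 (h k le_rfl)
  have hupd : ∀ (k : Fin p) (x : Outcome d) (a : Fin (d k)) (i : Fin p), i < k →
      Function.update x k a i = x i := fun k x a i hi => Function.update_of_ne hi.ne _ _
  have hsum : ∀ k x, ∑ a : Fin (d k), r k (Function.update x k a) = 1 := by
    intro k x
    obtain ⟨St, hS, hx, -⟩ := hCtx k x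
    have key : ∀ a : Fin (d k), r k (Function.update x k a) =
        margin (fun y => (u y : ℝ)) (insert k (Ctx k x)) (Function.update x k a) /
          margin (fun y => (u y : ℝ)) (Ctx k x) x := by
      intro a
      have hxa : Function.update x k a ∈ St := hmem k St hS x hx _ (hupd k x a)
      obtain ⟨h1, h2⟩ := hstage k St hS x hx
      obtain ⟨h3, h4⟩ := hstage k St hS _ hxa
      simp only [hr, ucount_cast]
      rw [(hSt k St hS x hx _ hxa).1]
      congr 1
      apply margin_congr'
      intro z
      rw [Finset.forall_mem_insert, Finset.forall_mem_insert, ← h4, h2]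
      refine and_congr_right fun _ => forall₂_congr fun i hi => ?_
      rw [hupd k x a i (h1 i hi)]
    rw [Finset.sum_congr rfl (fun a _ => key a), ← Finset.sum_div,
      margin_split _ _ _ (fun h => lt_irrefl _ (hlt k x k h)), div_self (hupos _ _).ne']
  have hprod := margin_prod r hloc hsum phat hphat
  have hcond : ∀ (k : Fin p) (x : Outcome d), cond phat k (x k) x = r k x := by
    intro k x
    unfold cond
    rw [Function.update_eq_self]
    have e1 : (Finset.univ.filter (fun i : Fin p => i ≤ k)) =
        Finset.univ.filter (fun i : Fin p => i.val < k.val + 1) := by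
      ext i
      simp only [Finset.mem_filter, Finset.mem_univ, true_and]
      exact Nat.lt_succ_iff.symm
    have e2 : (Finset.univ.filter (fun i : Fin p => i < k)) =
        Finset.univ.filter (fun i : Fin p => i.val < k.val) := by
      ext i
      simp only [Finset.mem_filter, Finset.mem_univ, true_and]
      exact Iff.rfl
    have e3 : (Finset.univ.filter (fun i : Fin p => i.val < k.val + 1)) =
        insert k (Finset.univ.filter (fun i : Fin p => i.val < k.val)) := by
      ext i; simp [Fin.ext_iff]; omega
    have hk := k.isLt
    rw [e1, e2, hprod (p - (k.val + 1)) (k.val + 1) (by omega),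
      hprod (p - k.val) k.val (by omega), e3, Finset.prod_insert (by simp)]
    exact mul_div_cancel_right₀ _ (Finset.prod_pos fun i _ => hrpos i x).ne'
  refine ⟨hcond, ?_⟩
  have hcond' : ∀ (k : Fin p) (x : Outcome d) (a : Fin (d k)),
      cond phat k a x = r k (Function.update x k a) := by
    intro k x a
    rw [← hcond]
    unfold cond
    rw [Function.update_self, Function.update_idem]
    congr 1
    apply margin_congr'
    intro z
    refine forall₂_congr fun i hi => ?_
    rw [hupd k x a i (by simpa using hi)]
  intro k St hS y hy y' hy' a
  rw [hcond', hcond']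
  exact (hSt k St hS _ (hmem k St hS y hy _ (hupd k y a)) _
    (hmem k St hS y' hy' _ (hupd k y' a))).2 (by simp)

end CStreeStmt14
end
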